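/- Let D, D′ ∈ X^n be datasets of equal size n that differ in exactly one coordinate (replace-one adjacency), with batch size k ≤ n and q = k/n < 1. Then for every α > 1 and every integer m ≥ 3, the T-step FSwoR DP-SGD mechanism satisfies D_α( M_{[0,T]}(D) ‖ M_{[0,T]}(D′) ) ≤ Σ_{t=0}^{T−1} (1/(α−1))·log[ 1 + q²·α·(α−1)·(e^{4/σ_t²} − e^{2/σ_t²}) + Σ_{j=3}^{m−1} (q^j/j!)·F̃_{α,σ_t,j} + Ẽ_{α,σ_t,m}(q) ]. -/

import Mathlib

open MeasureTheory Finset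

noncomputable section

/-- `p`-dimensional Gaussian density with mean `μ` and covariance `s² I`. -/
def gaussND {p : ℕ} (μ : EuclideanSpace ℝ (Fin p)) (s : ℝ)
    (x : EuclideanSpace ℝ (Fin p)) : ℝ :=
  (2 * Real.pi * s ^ 2) ^ (-(p : ℝ) / 2) * Real.exp (-‖x - μ‖ ^ 2 / (2 * s ^ 2))

/-- one-dimensional Gaussian density with mean `μ` and variance `s²`. -/
def gauss1 (μ s θ : ℝ) : ℝ :=
  (2 * Real.pi * s ^ 2) ^ (-(1 : ℝ) / 2) * Real.exp (-(θ - μ) ^ 2 / (2 * s ^ 2))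

/-- Rényi divergence of order `α` between densities `P` and `Q` w.r.t. the measure `ν`. -/
def renyiDiv {Ω : Type*} [MeasurableSpace Ω] (ν : Measure Ω) (α : ℝ) (P Q : Ω → ℝ) : ℝ :=
  (α - 1)⁻¹ * Real.log (∫ x, (P x / Q x) ^ α * Q x ∂ν)

/-- `M_{σ,k} = ∫ (N_{1,σ²/4}/N_{0,σ²/4} − 1)^k N_{0,σ²/4}`. -/
def Mcoef (σ : ℝ) (k : ℕ) : ℝ :=
  ∫ θ : ℝ, (gauss1 1 (σ / 2) θ / gauss1 0 (σ / 2) θ - 1) ^ k * gauss1 0 (σ / 2) θ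

/-- `B̃_{σ,j}`. -/
def Btil (σ : ℝ) (j : ℕ) : ℝ :=
  if Even j then Mcoef σ j else Real.sqrt (Mcoef σ (j - 1) * Mcoef σ (j + 1))

/-- `H_{α,σ}(q)`. -/
def Hfun (α σ q : ℝ) : ℝ :=
  ∫ θ : ℝ, (q * (gauss1 1 (σ / 2) θ / gauss1 0 (σ / 2) θ) + (1 - q)) ^ α * gauss1 0 (σ / 2) θ

/-- `R̃_{α,σ,3}(q)`. -/
def Rtil3 (α σ q : ℝ) : ℝ :=
  if 3 < α then
    q ^ 3 * α * (α - 1) * |α - 2| *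
      ((∑ ℓ ∈ Finset.range (⌈α⌉₊ - 3 + 1),
          q ^ ℓ * ((⌈α⌉₊ - 3).factorial : ℝ) /
            (((⌈α⌉₊ - 3 - ℓ).factorial : ℝ) * ((3 + ℓ).factorial : ℝ)) * Btil σ (ℓ + 3)) +
        1 / 6 * Btil σ 3)
  else
    q ^ 3 * α * (α - 1) * |α - 2| * (1 / 6 * (1 - q) ^ (α - 3) * Btil σ 3)

/-- `F̃_{α,σ,k}`. -/
def Ftil (α σ : ℝ) (k : ℕ) : ℝ :=
  (α - 1) * α ^ (k - 1) *
      (if Even k then 4 * Mcoef σ k else 3 * Real.sqrt (Mcoef σ (k - 1) * Mcoef σ (k + 1))) +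
    (α - 1) * α ^ (k - 1) *
      ∑ j ∈ Finset.range (k + 1),
        (k.choose j : ℝ) *
          |α / (α - 1) * (∏ ℓ ∈ Finset.range j, (1 - (ℓ : ℝ) / α)) *
              (∏ ℓ ∈ Finset.range (k - j), (1 + ((ℓ : ℝ) - 1) / α)) - 1| *
          Btil σ k

/-- `Ẽ_{α,σ,m}(q)`. -/
def Etil (α σ : ℝ) (m : ℕ) (q : ℝ) : ℝ :=
  (q ^ m / (m.factorial : ℝ)) *
    ∑ j ∈ Finset.range (m + 1),
      (1 - q) ^ (-(α + (m : ℝ) - (j : ℝ) - 1)) * (m.choose j : ℝ) *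
        (∏ ℓ ∈ Finset.range j, |α - (ℓ : ℝ)|) *
        (∏ ℓ ∈ Finset.range (m - j), (α + (ℓ : ℝ) - 1)) *
        (if α ≤ (j : ℝ) then (1 - q) ^ (α - (j : ℝ)) * Btil σ m
         else Btil σ m + ∑ ℓ ∈ Finset.range (⌈α⌉₊ - j + 1),
           q ^ ℓ * ((⌈α⌉₊ - j).factorial : ℝ) * (m.factorial : ℝ) /
             (((⌈α⌉₊ - j - ℓ).factorial : ℝ) * ((m + ℓ).factorial : ℝ)) * Btil σ (ℓ + m))

/-- clipping to norm at most `C`. -/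
def clip {E : Type*} [NormedAddCommGroup E] [NormedSpace ℝ E] (C : ℝ) (x : E) : E :=
  (max 1 (‖x‖ / C))⁻¹ • x

/-- DP-SGD one-step mean for an index batch `b`. -/
def muStep {X : Type*} {p n : ℕ} (C η : ℝ) (k : ℕ)
    (g : EuclideanSpace ℝ (Fin p) → X → EuclideanSpace ℝ (Fin p))
    (θ : EuclideanSpace ℝ (Fin p)) (b : Finset (Fin n)) (D : Fin n → X) :
    EuclideanSpace ℝ (Fin p) :=
  θ - (η / (k : ℝ)) • ∑ i ∈ b, clip C (g θ (D i))

/-- fixed-size without-replacement DP-SGD transition density. -/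
def pFSwoR {X : Type*} {p : ℕ} (C η σ : ℝ) (k : ℕ)
    (g : EuclideanSpace ℝ (Fin p) → X → EuclideanSpace ℝ (Fin p))
    (n : ℕ) (D : Fin n → X) (θ θ' : EuclideanSpace ℝ (Fin p)) : ℝ :=
  ((n.choose k : ℝ))⁻¹ *
    ∑ b ∈ Finset.powersetCard k (Finset.univ : Finset (Fin n)),
      gaussND (muStep C η k g θ b D) (C * η * σ / (k : ℝ)) θ'

/-- fixed-size with-replacement DP-SGD transition density. -/
def pFSwR {X : Type*} {p : ℕ} (C η σ : ℝ) (k : ℕ)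
    (g : EuclideanSpace ℝ (Fin p) → X → EuclideanSpace ℝ (Fin p))
    (n : ℕ) (D : Fin n → X) (θ θ' : EuclideanSpace ℝ (Fin p)) : ℝ :=
  (((n : ℝ)) ^ k)⁻¹ *
    ∑ b : Fin k → Fin n,
      gaussND (θ - (η / (k : ℝ)) • ∑ j : Fin k, clip C (g θ (D (b j))))
        (C * η * σ / (k : ℝ)) θ'

/-- Poisson-subsampled DP-SGD transition density with sampling probability `k/n`. -/
def pPoisson {X : Type*} {p : ℕ} (C η σ : ℝ) (k : ℕ)
    (g : EuclideanSpace ℝ (Fin p) → X → EuclideanSpace ℝ (Fin p))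
    (n : ℕ) (D : Fin n → X) (θ θ' : EuclideanSpace ℝ (Fin p)) : ℝ :=
  ∑ S : Finset (Fin n),
    ((k : ℝ) / n) ^ S.card * (1 - (k : ℝ) / n) ^ (n - S.card) *
      gaussND (muStep C η k g θ S D) (C * η * σ / (k : ℝ)) θ'

/-- removing the `i`-th entry of a tuple. -/
def removeIdx {X : Type*} {n : ℕ} (i : Fin (n + 1)) (D : Fin (n + 1) → X) : Fin n → X :=
  fun j => D (i.succAbove j)

/-- `D'` is obtained from `D` by removing one element. -/
def IsRemoveOne {X : Type*} {m n : ℕ} (D : Fin m → X) (D' : Fin n → X) : Prop :=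
  ∃ (h : n + 1 = m) (i : Fin (n + 1)), D' = removeIdx i (fun j => D (Fin.cast h j))

/-- add/remove adjacency. -/
def AdjAddRemove {X : Type*} {m n : ℕ} (D : Fin m → X) (D' : Fin n → X) : Prop :=
  IsRemoveOne D D' ∨ IsRemoveOne D' D

/-- replace-one adjacency: the datasets differ in exactly one coordinate. -/
def AdjReplaceOne {X : Type*} {n : ℕ} (D D' : Fin n → X) : Prop :=
  ∃ i : Fin n, D i ≠ D' i ∧ ∀ j : Fin n, j ≠ i → D j = D' j

/-- joint density of the `T`-step Markov chain (coordinates `Θ_1,…,Θ_T`),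
started at the deterministic point `θ₀`, with transition densities `ptrans t`. -/
def chainDensity {E : Type*} (T : ℕ) (ptrans : ℕ → E → E → ℝ) (θ₀ : E)
    (x : Fin T → E) : ℝ :=
  ∏ t : Fin T,
    ptrans t
      (if 0 < (t : ℕ) then
        x ⟨(t : ℕ) - 1, Nat.lt_of_le_of_lt (Nat.sub_le _ _) t.isLt⟩
      else θ₀)
      (x t)

/-! ### Gaussian densities on a finite-dimensional inner product space -/

section Gaussian

variable {V : Type*} [NormedAddCommGroup V] [InnerProductSpace ℝ V]

/-- Isotropic Gaussian density with mean `c` and standard deviation `s`. -/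
def gaussV (c : V) (s : ℝ) (x : V) : ℝ :=
  (2 * Real.pi * s ^ 2) ^ (-(Module.finrank ℝ V : ℝ) / 2) *
    Real.exp (-‖x - c‖ ^ 2 / (2 * s ^ 2))

/-- Likelihood ratio of two isotropic Gaussians with means `a` and `c`. -/
def likRatio (a c : V) (s : ℝ) (x : V) : ℝ := gaussV a s x / gaussV c s x

lemma gaussND_eq_gaussV {p : ℕ} (c : EuclideanSpace ℝ (Fin p)) (s : ℝ) :
    gaussND c s = gaussV c s := by
  funext x
  simp [gaussND, gaussV]

lemma gauss1_eq_gaussV (c s : ℝ) : gauss1 c s = gaussV c s := by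
  funext x
  simp [gauss1, gaussV]

lemma gaussV_pos (c : V) {s : ℝ} (hs : 0 < s) (x : V) : 0 < gaussV c s x := by
  unfold gaussV
  positivity

lemma continuous_gaussV (c : V) (s : ℝ) : Continuous (gaussV c s) := by
  unfold gaussV
  fun_prop

lemma gaussV_mul_exp (c w : V) {s : ℝ} (hs : 0 < s) (x : V) :
    gaussV c s x * Real.exp (inner ℝ (x - c) w / s ^ 2) =
      Real.exp (‖w‖ ^ 2 / (2 * s ^ 2)) * gaussV (c + w) s x := by
  unfold gaussV
  have h : ‖x - (c + w)‖ ^ 2 = ‖x - c‖ ^ 2 - 2 * inner ℝ (x - c) w + ‖w‖ ^ 2 := by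
    rw [← sub_sub, norm_sub_sq_real]
  rw [h, mul_assoc, ← Real.exp_add, mul_left_comm, ← Real.exp_add]
  congr 2
  field_simp
  ring

lemma likRatio_eq_exp (a c : V) {s : ℝ} (hs : 0 < s) (x : V) :
    likRatio a c s x =
      Real.exp (-(‖a - c‖ ^ 2 / (2 * s ^ 2))) * Real.exp (inner ℝ (x - c) (a - c) / s ^ 2) := by
  have h := gaussV_mul_exp c (a - c) hs x
  rw [add_sub_cancel] at h
  rw [likRatio, div_eq_iff (gaussV_pos c hs x).ne', mul_assoc, mul_comm (Real.exp (inner ℝ _ _ / _)),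
    h, ← mul_assoc, ← Real.exp_add]
  simp

lemma likRatio_pos (a c : V) {s : ℝ} (hs : 0 < s) (x : V) : 0 < likRatio a c s x :=
  div_pos (gaussV_pos a hs x) (gaussV_pos c hs x)

lemma gaussV_mul_likRatio (a c : V) {s : ℝ} (hs : 0 < s) (x : V) :
    gaussV c s x * likRatio a c s x = gaussV a s x :=
  mul_div_cancel₀ _ (gaussV_pos c hs x).ne'

lemma continuous_likRatio (a c : V) {s : ℝ} (hs : 0 < s) : Continuous (likRatio a c s) :=
  (continuous_gaussV a s).div (continuous_gaussV c s) fun x => (gaussV_pos c hs x).ne'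

lemma likRatio_pow_eq (a c : V) {s : ℝ} (hs : 0 < s) (i : ℕ) (x : V) :
    likRatio a c s x ^ i = Real.exp (-(i * (‖a - c‖ ^ 2 / (2 * s ^ 2)))) *
      Real.exp (inner ℝ (x - c) ((i : ℝ) • (a - c)) / s ^ 2) := by
  rw [likRatio_eq_exp a c hs, mul_pow, ← Real.exp_nat_mul, ← Real.exp_nat_mul, inner_smul_right]
  ring_nf

lemma likRatio_mul_likRatio_eq (a b c : V) {s : ℝ} (hs : 0 < s) (x : V) :
    likRatio a c s x * likRatio b c s x =
      Real.exp (-((‖a - c‖ ^ 2 + ‖b - c‖ ^ 2) / (2 * s ^ 2))) *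
      Real.exp (inner ℝ (x - c) ((a - c) + (b - c)) / s ^ 2) := by
  rw [likRatio_eq_exp a c hs, likRatio_eq_exp b c hs, inner_add_right, mul_mul_mul_comm,
    ← Real.exp_add, ← Real.exp_add]
  ring_nf

variable [MeasurableSpace V] [BorelSpace V]

lemma measurable_ofReal_gaussV (c : V) (s : ℝ) :
    Measurable fun x => ENNReal.ofReal (gaussV c s x) :=
  (continuous_gaussV c s).measurable.ennreal_ofReal

variable [FiniteDimensional ℝ V]

lemma integral_gaussV (c : V) {s : ℝ} (hs : 0 < s) : ∫ x, gaussV c s x = 1 := by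
  unfold gaussV
  rw [integral_const_mul,
    integral_sub_right_eq_self (fun x : V => Real.exp (-‖x‖ ^ 2 / (2 * s ^ 2))) c]
  have h := GaussianFourier.integral_rexp_neg_mul_sq_norm (V := V)
    (b := (2 * s ^ 2)⁻¹) (by positivity)
  have h2 : ∀ v : V, -‖v‖ ^ 2 / (2 * s ^ 2) = -(2 * s ^ 2)⁻¹ * ‖v‖ ^ 2 := fun v => by
    field_simp
  simp_rw [h2, h]
  rw [div_inv_eq_mul, show Real.pi * (2 * s ^ 2) = 2 * Real.pi * s ^ 2 by ring,
    ← Real.rpow_add (by positivity), neg_div, neg_add_cancel, Real.rpow_zero]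

lemma integrable_gaussV (c : V) {s : ℝ} (hs : 0 < s) : Integrable (gaussV c s) :=
  Integrable.of_integral_ne_zero (by rw [integral_gaussV c hs]; exact one_ne_zero)

/-- Isotropic Gaussian measure with mean `c` and standard deviation `s`. -/
def gaussMeasure (c : V) (s : ℝ) : Measure V :=
  volume.withDensity fun x => ENNReal.ofReal (gaussV c s x)

lemma integral_gaussMeasure (c : V) {s : ℝ} (hs : 0 < s) (f : V → ℝ) :
    ∫ x, f x ∂(gaussMeasure c s) = ∫ x, gaussV c s x * f x := by
  rw [gaussMeasure, integral_withDensity_eq_integral_toReal_smul (measurable_ofReal_gaussV c s)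
    (by simp)]
  simp [ENNReal.toReal_ofReal, (gaussV_pos c hs _).le]

lemma integrable_gaussMeasure_iff (c : V) {s : ℝ} (hs : 0 < s) (f : V → ℝ) :
    Integrable f (gaussMeasure c s) ↔ Integrable fun x => gaussV c s x * f x := by
  rw [gaussMeasure, integrable_withDensity_iff_integrable_smul' (measurable_ofReal_gaussV c s)
    (by simp)]
  simp [ENNReal.toReal_ofReal, (gaussV_pos c hs _).le]

lemma isProbabilityMeasure_gaussMeasure (c : V) {s : ℝ} (hs : 0 < s) :
    IsProbabilityMeasure (gaussMeasure c s) := by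
  constructor
  rw [gaussMeasure, withDensity_apply _ MeasurableSet.univ, Measure.restrict_univ,
    ← ofReal_integral_eq_lintegral_ofReal (integrable_gaussV c hs)
      (Filter.Eventually.of_forall fun x => (gaussV_pos c hs x).le), integral_gaussV c hs]
  simp

lemma integrable_exp_inner (c w : V) {s : ℝ} (hs : 0 < s) :
    Integrable (fun x => Real.exp (inner ℝ (x - c) w / s ^ 2)) (gaussMeasure c s) := by
  rw [integrable_gaussMeasure_iff c hs]
  simp_rw [gaussV_mul_exp c w hs]
  exact (integrable_gaussV _ hs).const_mul _

lemma integral_exp_inner (c w : V) {s : ℝ} (hs : 0 < s) :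
    ∫ x, Real.exp (inner ℝ (x - c) w / s ^ 2) ∂(gaussMeasure c s) =
      Real.exp (‖w‖ ^ 2 / (2 * s ^ 2)) := by
  rw [integral_gaussMeasure c hs]
  simp_rw [gaussV_mul_exp c w hs]
  rw [integral_const_mul, integral_gaussV _ hs, mul_one]

lemma integrable_likRatio_pow (a c : V) {s : ℝ} (hs : 0 < s) (i : ℕ) :
    Integrable (fun x => likRatio a c s x ^ i) (gaussMeasure c s) := by
  simp_rw [likRatio_pow_eq a c hs]
  exact (integrable_exp_inner c _ hs).const_mul _

lemma integral_likRatio_pow (a c : V) {s : ℝ} (hs : 0 < s) (i : ℕ) :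
    ∫ x, likRatio a c s x ^ i ∂(gaussMeasure c s) =
      Real.exp ((i : ℝ) * (i - 1) / 2 * (‖a - c‖ ^ 2 / s ^ 2)) := by
  simp_rw [likRatio_pow_eq a c hs]
  rw [integral_const_mul, integral_exp_inner c _ hs, ← Real.exp_add, norm_smul]
  congr 1
  simp
  field_simp
  ring

lemma integrable_likRatio_mul_likRatio (a b c : V) {s : ℝ} (hs : 0 < s) :
    Integrable (fun x => likRatio a c s x * likRatio b c s x) (gaussMeasure c s) := by
  simp_rw [likRatio_mul_likRatio_eq a b c hs]
  exact (integrable_exp_inner c _ hs).const_mul _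

lemma integral_likRatio_mul_likRatio (a b c : V) {s : ℝ} (hs : 0 < s) :
    ∫ x, likRatio a c s x * likRatio b c s x ∂(gaussMeasure c s) =
      Real.exp (inner ℝ (a - c) (b - c) / s ^ 2) := by
  simp_rw [likRatio_mul_likRatio_eq a b c hs]
  rw [integral_const_mul, integral_exp_inner c _ hs, ← Real.exp_add, norm_add_sq_real]
  congr 1
  field_simp
  ring

end Gaussian

/-! ### Moments of the centred likelihood ratio -/

/-- The `k`-th moment of `L - 1` for a log-normal `L` with mean one and log-variance `τ`. -/
def centredMoment (k : ℕ) (τ : ℝ) : ℝ :=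
  ∑ i ∈ range (k + 1), (k.choose i : ℝ) * (-1) ^ (k - i) * Real.exp ((i : ℝ) * (i - 1) / 2 * τ)

lemma sub_one_pow_eq_sum (y : ℝ) (k : ℕ) :
    (y - 1) ^ k = ∑ i ∈ range (k + 1), (k.choose i : ℝ) * (-1) ^ (k - i) * y ^ i := by
  rw [sub_eq_add_neg, add_pow]
  exact sum_congr rfl fun i _ => by ring

lemma sum_choose_mul_falling_eq (y : ℝ) (k : ℕ) :
    ∑ i ∈ range (k + 2 + 1), ((k + 2).choose i : ℝ) * (-1) ^ (k + 2 - i) * y ^ i *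
        ((i : ℝ) * (i - 1)) =
      ((k : ℝ) + 2) * (k + 1) * (y ^ 2 * (y - 1) ^ k) := by
  rw [sum_range_succ', sum_range_succ', sub_one_pow_eq_sum, mul_sum, mul_sum]
  simp only [Nat.cast_zero, zero_mul, mul_zero, add_zero, Nat.cast_add, Nat.cast_one, zero_add,
    sub_self]
  refine sum_congr rfl fun i hi => ?_
  have h1 : ((k : ℝ) + 2) * (k + 1) * (k.choose i) =
      ((k + 2).choose (i + 1 + 1)) * ((i : ℝ) + 1 + 1) * (i + 1) := by
    have e1 := Nat.add_one_mul_choose_eq (k + 1) (i + 1)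
    have e2 := Nat.add_one_mul_choose_eq k i
    have e3 : (k + 2) * ((k + 1) * k.choose i) =
        (k + 2).choose (i + 1 + 1) * (i + 1 + 1) * (i + 1) := by
      rw [e2, ← e1]; ring
    have e4 := congrArg (Nat.cast (R := ℝ)) e3
    push_cast at e4
    linarith
  rw [show k + 2 - (i + 1 + 1) = k - i by omega]
  linear_combination (-((-1) ^ (k - i) * y ^ (i + 2))) * h1

section Moments

variable {V : Type*} [NormedAddCommGroup V] [InnerProductSpace ℝ V] [MeasurableSpace V]
  [BorelSpace V] [FiniteDimensional ℝ V]

lemma integrable_likRatio_sub_one_pow (a c : V) {s : ℝ} (hs : 0 < s) (k : ℕ) :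
    Integrable (fun x => (likRatio a c s x - 1) ^ k) (gaussMeasure c s) := by
  simp_rw [sub_one_pow_eq_sum]
  exact integrable_finsetSum _ fun i _ => (integrable_likRatio_pow a c hs i).const_mul _

lemma integral_likRatio_sub_one_pow (a c : V) {s : ℝ} (hs : 0 < s) (k : ℕ) :
    ∫ x, (likRatio a c s x - 1) ^ k ∂(gaussMeasure c s) =
      centredMoment k (‖a - c‖ ^ 2 / s ^ 2) := by
  simp_rw [sub_one_pow_eq_sum]
  rw [integral_finsetSum _ fun i _ => (integrable_likRatio_pow a c hs i).const_mul _]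
  exact sum_congr rfl fun i _ => by rw [integral_const_mul, integral_likRatio_pow a c hs]

end Moments

lemma monotoneOn_centredMoment {k : ℕ} (hk : Even k) :
    MonotoneOn (centredMoment k) (Set.Ici 0) := by
  have hd : ∀ τ, HasDerivAt (centredMoment k)
      (∑ i ∈ range (k + 1), (k.choose i : ℝ) * (-1) ^ (k - i) *
        (Real.exp ((i : ℝ) * (i - 1) / 2 * τ) * ((i : ℝ) * (i - 1) / 2))) τ := fun τ => by
    unfold centredMoment
    refine HasDerivAt.fun_sum fun i _ => HasDerivAt.const_mul _ (HasDerivAt.exp ?_)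
    simpa using (hasDerivAt_id τ).const_mul ((i : ℝ) * (i - 1) / 2)
  refine monotoneOn_of_deriv_nonneg (convex_Ici 0)
    (fun τ _ => (hd τ).continuousAt.continuousWithinAt)
    (fun τ _ => (hd τ).differentiableAt.differentiableWithinAt) fun τ hτ => ?_
  rw [interior_Ici, Set.mem_Ioi] at hτ
  rw [(hd τ).deriv]
  match k, hk with
  | 0, _ => simp
  | 1, hk => simp at hk
  | k + 2, hk =>
    have hk' : Even k := by simpa [Nat.even_add] using hk
    have hint : ∫ x, (∑ i ∈ range (k + 2 + 1), ((k + 2).choose i : ℝ) * (-1) ^ (k + 2 - i) *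
        likRatio (Real.sqrt τ) 0 1 x ^ i * ((i : ℝ) * (i - 1))) ∂(gaussMeasure (0 : ℝ) 1) =
        ∑ i ∈ range (k + 2 + 1), ((k + 2).choose i : ℝ) * (-1) ^ (k + 2 - i) *
        (Real.exp ((i : ℝ) * (i - 1) / 2 * τ)) * ((i : ℝ) * (i - 1)) := by
      rw [integral_finsetSum _ fun i _ =>
        ((integrable_likRatio_pow _ _ one_pos i).const_mul _).mul_const _]
      refine sum_congr rfl fun i _ => ?_
      rw [integral_mul_const, integral_const_mul, integral_likRatio_pow _ _ one_pos]
      simp [Real.sq_sqrt hτ.le]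
    have hnn : 0 ≤ ∑ i ∈ range (k + 2 + 1), ((k + 2).choose i : ℝ) * (-1) ^ (k + 2 - i) *
        (Real.exp ((i : ℝ) * (i - 1) / 2 * τ)) * ((i : ℝ) * (i - 1)) := by
      rw [← hint]
      refine integral_nonneg fun x => ?_
      simp only [sum_choose_mul_falling_eq, Pi.zero_apply]
      have := hk'.pow_nonneg (likRatio (Real.sqrt τ) 0 1 x - 1)
      positivity
    have := div_nonneg hnn zero_le_two
    rw [sum_div] at this
    exact this.trans_eq (sum_congr rfl fun i _ => by ring)

lemma Mcoef_eq_centredMoment {σ : ℝ} (hσ : 0 < σ) (k : ℕ) :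
    Mcoef σ k = centredMoment k (4 / σ ^ 2) := by
  have h := integral_likRatio_sub_one_pow (1 : ℝ) 0 (half_pos hσ) k
  rw [integral_gaussMeasure _ (half_pos hσ)] at h
  have hM : Mcoef σ k =
      ∫ x, gaussV 0 (σ / 2) x * (likRatio (1 : ℝ) 0 (σ / 2) x - 1) ^ k := by
    simp only [Mcoef, gauss1_eq_gaussV, likRatio]
    exact integral_congr_ae (Filter.Eventually.of_forall fun x => mul_comm _ _)
  rw [hM, h]
  congr 1
  simp
  field_simp
  norm_num

section MomentBounds

variable {V : Type*} [NormedAddCommGroup V] [InnerProductSpace ℝ V] [MeasurableSpace V]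
  [BorelSpace V] [FiniteDimensional ℝ V]

lemma integral_likRatio_sub_one_pow_le_Mcoef {a c : V} {s σ : ℝ} (hs : 0 < s) (hσ : 0 < σ)
    (hac : ‖a - c‖ ^ 2 / s ^ 2 ≤ 4 / σ ^ 2) {k : ℕ} (hk : Even k) :
    ∫ x, (likRatio a c s x - 1) ^ k ∂(gaussMeasure c s) ≤ Mcoef σ k := by
  rw [integral_likRatio_sub_one_pow a c hs, Mcoef_eq_centredMoment hσ]
  exact monotoneOn_centredMoment hk (Set.mem_Ici.2 (by positivity)) (Set.mem_Ici.2 (by positivity))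
    hac

lemma integrable_abs_likRatio_sub_one_pow (a c : V) {s : ℝ} (hs : 0 < s) (k : ℕ) :
    Integrable (fun x => |likRatio a c s x - 1| ^ k) (gaussMeasure c s) := by
  simp_rw [← abs_pow]
  exact (integrable_likRatio_sub_one_pow a c hs k).abs

lemma integral_abs_likRatio_sub_one_pow_le_Btil {a c : V} {s σ : ℝ} (hs : 0 < s) (hσ : 0 < σ)
    (hac : ‖a - c‖ ^ 2 / s ^ 2 ≤ 4 / σ ^ 2) (k : ℕ) :
    ∫ x, |likRatio a c s x - 1| ^ k ∂(gaussMeasure c s) ≤ Btil σ k := by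
  rw [Btil]
  split_ifs with hk
  · simp_rw [hk.pow_abs]
    exact integral_likRatio_sub_one_pow_le_Mcoef hs hσ hac hk
  · obtain ⟨l, rfl⟩ := Nat.not_even_iff_odd.1 hk
    have hI := integrable_abs_likRatio_sub_one_pow a c hs
    set I : ℕ → ℝ := fun k => ∫ x, |likRatio a c s x - 1| ^ k ∂(gaussMeasure c s) with hIdef
    have hnn : ∀ k, 0 ≤ I k := fun k => integral_nonneg fun x => by positivity
    have hM : ∀ j, Even j → I j ≤ Mcoef σ j := fun j hj => by
      simp_rw [hIdef, hj.pow_abs]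
      exact integral_likRatio_sub_one_pow_le_Mcoef hs hσ hac hj
    have hquad : ∀ r : ℝ, 0 ≤ I (2 * l) * (r * r) + (-2 * I (2 * l + 1)) * r + I (2 * l + 2) :=
      fun r => by
        have h1 : 0 ≤ ∫ x, |likRatio a c s x - 1| ^ (2 * l) * (r * r) +
            |likRatio a c s x - 1| ^ (2 * l + 1) * (-2 * r) +
            |likRatio a c s x - 1| ^ (2 * l + 2) ∂(gaussMeasure c s) :=
          integral_nonneg fun x => by
            have : 0 ≤ |likRatio a c s x - 1| ^ (2 * l) * (|likRatio a c s x - 1| - r) ^ 2 := by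
              positivity
            refine this.trans_eq ?_
            ring
        have h2 := (hI (2 * l)).mul_const (r * r)
        have h3 := (hI (2 * l + 1)).mul_const (-2 * r)
        have h23 : Integrable (fun x => |likRatio a c s x - 1| ^ (2 * l) * (r * r) +
            |likRatio a c s x - 1| ^ (2 * l + 1) * (-2 * r)) (gaussMeasure c s) := h2.add h3
        rw [integral_add h23 (hI _), integral_add h2 h3, integral_mul_const,
          integral_mul_const] at h1
        linarith
    have hdisc := discrim_le_zero hquad
    rw [discrim] at hdisc
    refine Real.le_sqrt_of_sq_le ?_
    calc I (2 * l + 1) ^ 2 ≤ I (2 * l) * I (2 * l + 2) := by nlinarith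
      _ ≤ Mcoef σ (2 * l) * Mcoef σ (2 * l + 2) :=
        mul_le_mul (hM _ (even_two_mul l)) (hM _ ⟨l + 1, by ring⟩) (hnn _)
          ((hnn _).trans (hM _ (even_two_mul l)))

lemma pow_mul_pow_le_weighted {y z : ℝ} (hy : 0 ≤ y) (hz : 0 ≤ z) {i j : ℕ} (hij : 0 < i + j) :
    y ^ i * z ^ j ≤ (i : ℝ) / (i + j) * y ^ (i + j) + (j : ℝ) / (i + j) * z ^ (i + j) := by
  have h0 : (0 : ℝ) < i + j := by exact_mod_cast hij
  have h := Real.geom_mean_le_arith_mean2_weighted (w₁ := (i : ℝ) / (i + j))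
    (w₂ := (j : ℝ) / (i + j)) (by positivity) (by positivity)
    (pow_nonneg hy (i + j)) (pow_nonneg hz (i + j)) (by field_simp)
  have key : ∀ (t : ℝ) (l : ℕ), 0 ≤ t → (t ^ (i + j)) ^ ((l : ℝ) / (i + j)) = t ^ l :=
    fun t l ht => by
      rw [← Real.rpow_natCast t (i + j), ← Real.rpow_mul ht]
      push_cast
      rw [mul_div_cancel₀ _ h0.ne', Real.rpow_natCast]
  rwa [key y i hy, key z j hz] at h

lemma integrable_abs_pow_mul_abs_pow (a b c : V) {s : ℝ} (hs : 0 < s) (i j : ℕ) :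
    Integrable (fun x => |likRatio a c s x - 1| ^ i * |likRatio b c s x - 1| ^ j)
      (gaussMeasure c s) := by
  rcases Nat.eq_zero_or_pos (i + j) with h | h
  · obtain ⟨rfl, rfl⟩ : i = 0 ∧ j = 0 := by omega
    have := isProbabilityMeasure_gaussMeasure c hs
    simp
  · refine (((integrable_abs_likRatio_sub_one_pow a c hs (i + j)).const_mul
      ((i : ℝ) / (i + j))).add ((integrable_abs_likRatio_sub_one_pow b c hs (i + j)).const_mul
      ((j : ℝ) / (i + j)))).mono' ?_ (Filter.Eventually.of_forall fun x => ?_)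
    · have h1 := continuous_likRatio a c hs
      have h2 := continuous_likRatio b c hs
      exact Continuous.aestronglyMeasurable (by fun_prop)
    · rw [Real.norm_of_nonneg (by positivity)]
      exact pow_mul_pow_le_weighted (abs_nonneg _) (abs_nonneg _) h

lemma integral_abs_pow_mul_abs_pow_le_Btil {a b c : V} {s σ : ℝ} (hs : 0 < s) (hσ : 0 < σ)
    (hac : ‖a - c‖ ^ 2 / s ^ 2 ≤ 4 / σ ^ 2) (hbc : ‖b - c‖ ^ 2 / s ^ 2 ≤ 4 / σ ^ 2)
    {i j : ℕ} (hij : 0 < i + j) :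
    ∫ x, |likRatio a c s x - 1| ^ i * |likRatio b c s x - 1| ^ j ∂(gaussMeasure c s) ≤
      Btil σ (i + j) := by
  have h0 : (0 : ℝ) < i + j := by exact_mod_cast hij
  have hia := (integrable_abs_likRatio_sub_one_pow a c hs (i + j)).const_mul ((i : ℝ) / (i + j))
  have hib := (integrable_abs_likRatio_sub_one_pow b c hs (i + j)).const_mul ((j : ℝ) / (i + j))
  calc _ ≤ ∫ x, ((i : ℝ) / (i + j) * |likRatio a c s x - 1| ^ (i + j) +
        (j : ℝ) / (i + j) * |likRatio b c s x - 1| ^ (i + j)) ∂(gaussMeasure c s) :=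
        integral_mono (integrable_abs_pow_mul_abs_pow a b c hs i j) (hia.add hib) fun x =>
          pow_mul_pow_le_weighted (abs_nonneg _) (abs_nonneg _) hij
    _ ≤ (i : ℝ) / (i + j) * Btil σ (i + j) + (j : ℝ) / (i + j) * Btil σ (i + j) := by
        rw [integral_add hia hib, integral_const_mul, integral_const_mul]
        gcongr
        · exact integral_abs_likRatio_sub_one_pow_le_Btil hs hσ hac _
        · exact integral_abs_likRatio_sub_one_pow_le_Btil hs hσ hbc _
    _ = Btil σ (i + j) := by field_simp

end MomentBounds

lemma ternary_pow_le {p q r : ℝ} (hq : 0 < q) (hr : 0 < r) (hqp : q ≤ p)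
    {k : ℕ} (hk : 0 < k) :
    r * (p / r - q / r) ^ k ≤
      r * |p / r - 1| ^ k + r * |q / r - 1| ^ k + q * |p / q - 1| ^ k := by
  have h1 : 0 ≤ r * |p / r - 1| ^ k := by positivity
  have h2 : 0 ≤ r * |q / r - 1| ^ k := by positivity
  have h3 : 0 ≤ q * |p / q - 1| ^ k := by positivity
  have h0 : 0 ≤ p / r - q / r := sub_nonneg.2 (by gcongr)
  rcases le_total r q with hrq | hqr
  · have : r * (p / r - q / r) ^ k ≤ r * |p / r - 1| ^ k := by
      gcongr
      refine le_trans ?_ (le_abs_self _)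
      have : 1 ≤ q / r := (one_le_div hr).2 hrq
      linarith
    linarith
  rcases le_total p r with hpr | hrp
  · have : r * (p / r - q / r) ^ k ≤ r * |q / r - 1| ^ k := by
      gcongr
      refine le_trans ?_ (neg_le_abs _)
      have : p / r ≤ 1 := (div_le_one hr).2 hpr
      linarith
    linarith
  · have : r * (p / r - q / r) ^ k ≤ q * |p / q - 1| ^ k := by
      obtain ⟨l, rfl⟩ : ∃ l, k = l + 1 := ⟨k - 1, by omega⟩
      have e1 : r * (p / r - q / r) ^ (l + 1) = (p - q) * ((p - q) / r) ^ l := by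
        rw [← sub_div, pow_succ]; field_simp
      have e2 : q * |p / q - 1| ^ (l + 1) = (p - q) * ((p - q) / q) ^ l := by
        rw [div_sub_one hq.ne', abs_of_nonneg (div_nonneg (sub_nonneg.2 hqp) hq.le), pow_succ]
        field_simp
      rw [e1, e2]
      have := sub_nonneg.2 hqp
      gcongr
    linarith

lemma ternary_pow_le_of_odd {p q r : ℝ} (hq : 0 < q) (hr : 0 < r) {k : ℕ}
    (hk : Odd k) :
    r * (p / r - q / r) ^ k ≤
      r * |p / r - 1| ^ k + r * |q / r - 1| ^ k + q * |p / q - 1| ^ k := by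
  rcases le_total q p with h | h
  · exact ternary_pow_le hq hr h hk.pos
  · have h0 : r * (p / r - q / r) ^ k ≤ 0 :=
      mul_nonpos_of_nonneg_of_nonpos hr.le
        (hk.pow_nonpos_iff.2 (sub_nonpos.2 (by gcongr)))
    exact h0.trans (by positivity)

lemma ternary_pow_le_of_even {p q r : ℝ} (hp : 0 < p) (hq : 0 < q) (hr : 0 < r) {k : ℕ}
    (hk : Even k) (hk0 : 0 < k) :
    r * (p / r - q / r) ^ k ≤
      r * |p / r - 1| ^ k + r * |q / r - 1| ^ k + q * |p / q - 1| ^ k + p * |q / p - 1| ^ k := by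
  have h3 : 0 ≤ q * |p / q - 1| ^ k := by positivity
  have h4 : 0 ≤ p * |q / p - 1| ^ k := by positivity
  rcases le_total q p with h | h
  · linarith [ternary_pow_le hq hr h hk0]
  · rw [← neg_sub, hk.neg_pow]
    linarith [ternary_pow_le hp hr h hk0]

section TernaryBounds

variable {V : Type*} [NormedAddCommGroup V] [InnerProductSpace ℝ V] [MeasurableSpace V]
  [BorelSpace V] [FiniteDimensional ℝ V]

lemma integrable_likRatio_sub_likRatio_pow (a b c : V) {s : ℝ} (hs : 0 < s) (k : ℕ) :
    Integrable (fun x => (likRatio a c s x - likRatio b c s x) ^ k) (gaussMeasure c s) := by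
  have h : ∀ x, (likRatio a c s x - likRatio b c s x) ^ k =
      ∑ i ∈ range (k + 1), (likRatio a c s x - 1) ^ i * (likRatio b c s x - 1) ^ (k - i) *
        ((-1) ^ (k - i) * (k.choose i : ℝ)) := fun x => by
    rw [show likRatio a c s x - likRatio b c s x =
      (likRatio a c s x - 1) + -(likRatio b c s x - 1) by ring, add_pow]
    refine sum_congr rfl fun i _ => ?_
    rw [neg_pow]
    ring
  simp_rw [h]
  refine integrable_finsetSum _ fun i _ => Integrable.mul_const ?_ _
  refine (integrable_abs_pow_mul_abs_pow a b c hs i (k - i)).mono ?_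
    (Filter.Eventually.of_forall fun x => by simp)
  have h1 := continuous_likRatio a c hs
  have h2 := continuous_likRatio b c hs
  exact Continuous.aestronglyMeasurable (by fun_prop)

lemma integral_likRatio_sub_likRatio_pow_le {a b c : V} {s σ : ℝ} (hs : 0 < s) (hσ : 0 < σ)
    (hac : ‖a - c‖ ^ 2 / s ^ 2 ≤ 4 / σ ^ 2) (hbc : ‖b - c‖ ^ 2 / s ^ 2 ≤ 4 / σ ^ 2)
    (hab : ‖a - b‖ ^ 2 / s ^ 2 ≤ 4 / σ ^ 2) {k : ℕ} (hk : 0 < k) :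
    ∫ x, (likRatio a c s x - likRatio b c s x) ^ k ∂(gaussMeasure c s) ≤
      if Even k then 4 * Mcoef σ k else 3 * Real.sqrt (Mcoef σ (k - 1) * Mcoef σ (k + 1)) := by
  have hba : ‖b - a‖ ^ 2 / s ^ 2 ≤ 4 / σ ^ 2 := by rwa [norm_sub_rev]
  have I0 := (integrable_gaussMeasure_iff c hs _).1 (integrable_likRatio_sub_likRatio_pow a b c hs k)
  have hI : ∀ a c : V, Integrable fun x => gaussV c s x * |likRatio a c s x - 1| ^ k := fun a c =>
    (integrable_gaussMeasure_iff c hs _).1 (integrable_abs_likRatio_sub_one_pow a c hs k)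
  have hB : ∀ a c : V, ‖a - c‖ ^ 2 / s ^ 2 ≤ 4 / σ ^ 2 →
      ∫ x, gaussV c s x * |likRatio a c s x - 1| ^ k ≤ Btil σ k := fun a c h => by
    rw [← integral_gaussMeasure c hs]
    exact integral_abs_likRatio_sub_one_pow_le_Btil hs hσ h k
  have h12 : Integrable fun x => gaussV c s x * |likRatio a c s x - 1| ^ k +
      gaussV c s x * |likRatio b c s x - 1| ^ k := (hI a c).add (hI b c)
  have h123 : Integrable fun x => gaussV c s x * |likRatio a c s x - 1| ^ k +
      gaussV c s x * |likRatio b c s x - 1| ^ k + gaussV b s x * |likRatio a b s x - 1| ^ k :=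
    h12.add (hI a b)
  have hB1 := hB a c hac
  have hB2 := hB b c hbc
  have hB3 := hB a b hab
  have hB4 := hB b a hba
  rw [integral_gaussMeasure c hs]
  rw [Btil] at hB1 hB2 hB3 hB4
  split_ifs with hev
  · rw [if_pos hev] at hB1 hB2 hB3 hB4
    refine (integral_mono I0 (h123.add (hI b a)) fun x => ternary_pow_le_of_even (gaussV_pos a hs x)
      (gaussV_pos b hs x) (gaussV_pos c hs x) hev hk).trans ?_
    simp only [Pi.add_apply]
    rw [integral_add h123 (hI b a), integral_add h12 (hI a b), integral_add (hI a c) (hI b c)]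
    linarith
  · rw [if_neg hev] at hB1 hB2 hB3 hB4
    refine (integral_mono I0 h123 fun x => ternary_pow_le_of_odd
      (gaussV_pos b hs x) (gaussV_pos c hs x) (Nat.not_even_iff_odd.1 hev)).trans ?_
    rw [integral_add h12 (hI a b), integral_add (hI a c) (hI b c)]
    linarith

lemma exp_add_exp_sub_le {x y S : ℝ} (hx : 0 ≤ x) (hy : 0 ≤ y) (hxS : x ≤ S) (hyS : y ≤ S) :
    Real.exp x + Real.exp y - 2 * Real.exp ((x + y - S) / 2) ≤
      2 * (Real.exp S - Real.exp (S / 2)) := by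
  have step : ∀ x z : ℝ, 0 ≤ x → x ≤ S → z ≤ 0 →
      Real.exp x - 2 * Real.exp (x / 2 + z) ≤ Real.exp S - 2 * Real.exp (S / 2 + z) :=
    fun x z hx hxS hz => by
      have e1 : Real.exp x = Real.exp (x / 2) ^ 2 := by rw [← Real.exp_nat_mul]; ring_nf
      have e2 : Real.exp S = Real.exp (S / 2) ^ 2 := by rw [← Real.exp_nat_mul]; ring_nf
      have h1 : Real.exp (x / 2) ≤ Real.exp (S / 2) := Real.exp_le_exp.2 (by linarith)
      have h2 : 1 ≤ Real.exp (x / 2) := Real.one_le_exp (by linarith)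
      have h3 : Real.exp z ≤ 1 := Real.exp_le_one_iff.2 hz
      rw [Real.exp_add, Real.exp_add, e1, e2]
      nlinarith [mul_nonneg (sub_nonneg.2 h1)
        (show 0 ≤ Real.exp (x / 2) + Real.exp (S / 2) - 2 * Real.exp z by linarith)]
  have h1 := step x ((y - S) / 2) hx hxS (by linarith)
  have h2 := step y 0 hy hyS le_rfl
  rw [show (x + y - S) / 2 = x / 2 + (y - S) / 2 by ring]
  rw [show S / 2 + (y - S) / 2 = y / 2 + 0 by ring] at h1
  rw [add_zero (S / 2)] at h2
  linarith

lemma integral_likRatio_sub_likRatio_sq_le {a b c : V} {s σ : ℝ} (hs : 0 < s)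
    (hac : ‖a - c‖ ^ 2 / s ^ 2 ≤ 4 / σ ^ 2) (hbc : ‖b - c‖ ^ 2 / s ^ 2 ≤ 4 / σ ^ 2)
    (hab : ‖a - b‖ ^ 2 / s ^ 2 ≤ 4 / σ ^ 2) :
    ∫ x, (likRatio a c s x - likRatio b c s x) ^ 2 ∂(gaussMeasure c s) ≤
      2 * (Real.exp (4 / σ ^ 2) - Real.exp (2 / σ ^ 2)) := by
  have hI : ∀ x, (likRatio a c s x - likRatio b c s x) ^ 2 =
      likRatio a c s x ^ 2 + likRatio b c s x ^ 2 - likRatio a c s x * likRatio b c s x * 2 :=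
    fun x => by ring
  have h1 := integrable_likRatio_pow a c hs 2
  have h2 := integrable_likRatio_pow b c hs 2
  have h12 : Integrable (fun x => likRatio a c s x ^ 2 + likRatio b c s x ^ 2)
    (gaussMeasure c s) := h1.add h2
  have h3 := (integrable_likRatio_mul_likRatio a b c hs).mul_const 2
  simp_rw [hI]
  rw [integral_sub h12 h3, integral_add h1 h2, integral_mul_const, integral_likRatio_pow a c hs,
    integral_likRatio_pow b c hs, integral_likRatio_mul_likRatio a b c hs]
  have h := exp_add_exp_sub_le (S := 4 / σ ^ 2) (x := ‖a - c‖ ^ 2 / s ^ 2)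
    (y := ‖b - c‖ ^ 2 / s ^ 2) (by positivity) (by positivity) hac hbc
  have hin : (‖a - c‖ ^ 2 / s ^ 2 + ‖b - c‖ ^ 2 / s ^ 2 - 4 / σ ^ 2) / 2 ≤
      inner ℝ (a - c) (b - c) / s ^ 2 := by
    have hn : ‖a - b‖ ^ 2 = ‖a - c‖ ^ 2 - 2 * inner ℝ (a - c) (b - c) + ‖b - c‖ ^ 2 := by
      rw [← norm_sub_sq_real, sub_sub_sub_cancel_right]
    rw [hn, add_div, sub_div, mul_div_assoc] at hab
    linarith
  have hexp := Real.exp_le_exp.2 hin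
  rw [show (4 / σ ^ 2) / 2 = 2 / σ ^ 2 by ring] at h
  norm_num
  linarith

lemma integral_likRatio_sub_one (a c : V) {s : ℝ} (hs : 0 < s) :
    ∫ x, (likRatio a c s x - 1) ∂(gaussMeasure c s) = 0 := by
  have := isProbabilityMeasure_gaussMeasure c hs
  have h1 := integrable_likRatio_pow a c hs 1
  have h2 := integral_likRatio_pow a c hs 1
  simp only [pow_one] at h1 h2
  rw [integral_sub h1 (integrable_const _), h2]
  simp

end TernaryBounds

/-! ### A pointwise Taylor bound for `(1 + q u) ^ α * (1 + q v) ^ (1 - α)` -/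

lemma hasDerivAt_pow_div_factorial (n : ℕ) (t : ℝ) :
    HasDerivAt (fun t : ℝ => t ^ (n + 1) / ((n + 1).factorial : ℝ)) (t ^ n / (n.factorial : ℝ)) t := by
  have h := (hasDerivAt_pow (n + 1) t).div_const ((n + 1).factorial : ℝ)
  refine h.congr_deriv ?_
  rw [Nat.factorial_succ]
  push_cast
  field_simp

/-- Taylor's formula as a one-sided comparison: if the `m`-th derivative of `φ 0` is at most `ψ 0`,
the remainder is at most the `m`-fold primitive `ψ m` of `ψ 0`. -/
lemma le_taylor_add_of_le {q : ℝ} (ψ : ℕ → ℝ → ℝ)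
    (hψ : ∀ i t, HasDerivAt (ψ (i + 1)) (ψ i t) t) (hψ0 : ∀ i, ψ (i + 1) 0 = 0)
    (m : ℕ) (φ : ℕ → ℝ → ℝ)
    (hφ : ∀ i, ∀ t ∈ Set.Icc 0 q, HasDerivAt (φ i) (φ (i + 1) t) t)
    (hle : ∀ t ∈ Set.Icc 0 q, φ m t ≤ ψ 0 t) :
    ∀ t ∈ Set.Icc 0 q,
      φ 0 t ≤ ∑ k ∈ range m, t ^ k / (k.factorial : ℝ) * φ k 0 + ψ m t := by
  induction m generalizing φ with
  | zero => simpa using hle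
  | succ m ih =>
    have h1 := ih (fun i => φ (i + 1)) (fun i => hφ (i + 1)) hle
    have hd : ∀ t, HasDerivAt
        (fun t => ∑ k ∈ range (m + 1), t ^ k / (k.factorial : ℝ) * φ k 0 + ψ (m + 1) t)
        (∑ k ∈ range m, t ^ k / (k.factorial : ℝ) * φ (k + 1) 0 + ψ m t) t := fun t => by
      refine HasDerivAt.add ?_ (hψ m t)
      simp_rw [sum_range_succ' _ m]
      simp only [pow_zero]
      exact (HasDerivAt.fun_sum fun k _ =>
        (hasDerivAt_pow_div_factorial k t).mul_const _).add_const _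
    have hmono : MonotoneOn (fun t => (∑ k ∈ range (m + 1), t ^ k / (k.factorial : ℝ) * φ k 0 +
        ψ (m + 1) t) - φ 0 t) (Set.Icc 0 q) := by
      have hD : ∀ t ∈ Set.Icc 0 q, HasDerivAt (fun t => (∑ k ∈ range (m + 1),
          t ^ k / (k.factorial : ℝ) * φ k 0 + ψ (m + 1) t) - φ 0 t)
          ((∑ k ∈ range m, t ^ k / (k.factorial : ℝ) * φ (k + 1) 0 + ψ m t) - φ 1 t) t :=
        fun t ht => (hd t).sub (hφ 0 t ht)
      refine monotoneOn_of_deriv_nonneg (convex_Icc 0 q)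
        (fun t ht => (hD t ht).continuousAt.continuousWithinAt)
        (fun t ht => (hD t (interior_subset ht)).differentiableAt.differentiableWithinAt)
        fun t ht => ?_
      rw [(hD t (interior_subset ht)).deriv]
      exact sub_nonneg.2 (h1 t (interior_subset ht))
    intro t ht
    have h := hmono ⟨le_rfl, ht.1.trans ht.2⟩ ht ht.1
    simp only [hψ0, sum_range_succ' _ m, add_zero, zero_pow (Nat.succ_ne_zero _), zero_div, zero_mul,
      sum_const_zero, pow_zero, Nat.factorial_zero, Nat.cast_one, div_one, one_mul, zero_add,
      sub_self] at h ⊢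
    linarith

/-- The `i`-th derivative of `t ↦ (1 + t * u) ^ β`. -/
def powDeriv (β u : ℝ) (i : ℕ) (t : ℝ) : ℝ :=
  (∏ ℓ ∈ range i, (β - (ℓ : ℝ))) * u ^ i * (1 + t * u) ^ (β - (i : ℝ))

lemma hasDerivAt_powDeriv (β : ℝ) {u t : ℝ} (h : 0 < 1 + t * u) (i : ℕ) :
    HasDerivAt (powDeriv β u i) (powDeriv β u (i + 1) t) t := by
  have h1 : HasDerivAt (fun t : ℝ => 1 + t * u) u t := by
    simpa using ((hasDerivAt_id t).mul_const u).const_add 1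
  have h2 := (h1.rpow_const (p := β - i) (Or.inl h.ne')).const_mul
    ((∏ ℓ ∈ range i, (β - (ℓ : ℝ))) * u ^ i)
  refine h2.congr_deriv ?_
  rw [powDeriv, prod_range_succ]
  push_cast
  rw [sub_add_eq_sub_sub]
  ring

/-- The `k`-th derivative of `t ↦ (1 + t * u) ^ α * (1 + t * v) ^ (1 - α)`. -/
def prodDeriv (α u v : ℝ) (k : ℕ) (t : ℝ) : ℝ :=
  ∑ ij ∈ antidiagonal k,
    (k.choose ij.1 : ℝ) * (powDeriv α u ij.1 t * powDeriv (1 - α) v ij.2 t)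

lemma hasDerivAt_prodDeriv (α : ℝ) {u v t : ℝ} (hu : 0 < 1 + t * u) (hv : 0 < 1 + t * v) (k : ℕ) :
    HasDerivAt (prodDeriv α u v k) (prodDeriv α u v (k + 1) t) t := by
  have h := HasDerivAt.fun_sum (u := antidiagonal k) fun ij _ =>
    ((hasDerivAt_powDeriv α hu ij.1).mul (hasDerivAt_powDeriv (1 - α) hv ij.2)).const_mul
      (k.choose ij.1 : ℝ)
  refine h.congr_deriv ?_
  rw [prodDeriv, sum_antidiagonal_choose_succ_mul
    (fun i j => powDeriv α u i t * powDeriv (1 - α) v j t), ← sum_add_distrib]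
  refine sum_congr rfl fun ij hij => ?_
  rw [Nat.choose_symm_of_eq_add (mem_antidiagonal.1 hij).symm]
  ring

lemma prodDeriv_zero (α u v t : ℝ) :
    prodDeriv α u v 0 t = (1 + t * u) ^ α * (1 + t * v) ^ (1 - α) := by
  simp [prodDeriv, powDeriv]

lemma prodDeriv_at_zero (α u v : ℝ) (k : ℕ) :
    prodDeriv α u v k 0 = ∑ j ∈ range (k + 1), (k.choose j : ℝ) *
      (∏ ℓ ∈ range j, (α - (ℓ : ℝ))) * (∏ ℓ ∈ range (k - j), (1 - α - (ℓ : ℝ))) *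
        (u ^ j * v ^ (k - j)) := by
  rw [prodDeriv, Nat.sum_antidiagonal_eq_sum_range_succ_mk]
  refine sum_congr rfl fun j _ => ?_
  simp [powDeriv]
  ring

/-- The shape shared by `Etil` and its pointwise counterpart, with the moments replaced by `W`. -/
def taylorRemainder (α : ℝ) (m : ℕ) (q : ℝ) (W : ℕ → ℕ → ℝ) : ℝ :=
  (q ^ m / (m.factorial : ℝ)) *
    ∑ j ∈ Finset.range (m + 1),
      (1 - q) ^ (-(α + (m : ℝ) - (j : ℝ) - 1)) * (m.choose j : ℝ) *
        (∏ ℓ ∈ Finset.range j, |α - (ℓ : ℝ)|) *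
        (∏ ℓ ∈ Finset.range (m - j), (α + (ℓ : ℝ) - 1)) *
        (if α ≤ (j : ℝ) then (1 - q) ^ (α - (j : ℝ)) * W j 0
         else W j 0 + ∑ ℓ ∈ Finset.range (⌈α⌉₊ - j + 1),
           q ^ ℓ * ((⌈α⌉₊ - j).factorial : ℝ) * (m.factorial : ℝ) /
             (((⌈α⌉₊ - j - ℓ).factorial : ℝ) * ((m + ℓ).factorial : ℝ)) * W j ℓ)

lemma Etil_eq_taylorRemainder (α σ : ℝ) (m : ℕ) (q : ℝ) :
    Etil α σ m q = taylorRemainder α m q fun _ ℓ => Btil σ (ℓ + m) := by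
  simp only [Etil, taylorRemainder, zero_add]

lemma taylorRemainder_mono {α : ℝ} (hα : 1 < α) (m : ℕ) {q : ℝ} (hq0 : 0 ≤ q) (hq1 : q < 1)
    {W W' : ℕ → ℕ → ℝ} (h : ∀ j ≤ m, ∀ ℓ, W j ℓ ≤ W' j ℓ) :
    taylorRemainder α m q W ≤ taylorRemainder α m q W' := by
  have h1 : 0 < 1 - q := sub_pos.2 hq1
  unfold taylorRemainder
  refine mul_le_mul_of_nonneg_left (sum_le_sum fun j hj => ?_) (by positivity)
  have hj' : j ≤ m := Nat.lt_succ_iff.1 (mem_range.1 hj)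
  have hp : 0 ≤ ∏ ℓ ∈ range (m - j), (α + (ℓ : ℝ) - 1) :=
    prod_nonneg fun ℓ _ => by
      have : (0 : ℝ) ≤ ℓ := ℓ.cast_nonneg
      linarith
  refine mul_le_mul_of_nonneg_left ?_ (by positivity)
  split_ifs
  · exact mul_le_mul_of_nonneg_left (h j hj' 0) (by positivity)
  · exact add_le_add (h j hj' 0) (sum_le_sum fun ℓ _ =>
      mul_le_mul_of_nonneg_left (h j hj' ℓ) (by positivity))

lemma taylorRemainder_zero (α : ℝ) (m : ℕ) (q : ℝ) : taylorRemainder α m q (fun _ _ => 0) = 0 := by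
  simp [taylorRemainder]

lemma rpow_le_one_add_pow {α y : ℝ} (hy : 0 < y) {j : ℕ} (hj : (j : ℝ) < α) :
    y ^ (α - (j : ℝ)) ≤ 1 + y ^ (⌈α⌉₊ - j) := by
  rcases le_total y 1 with h | h
  · exact (Real.rpow_le_one hy.le h (sub_pos.2 hj).le).trans (by simpa using (pow_pos hy _).le)
  · have hjc : j ≤ ⌈α⌉₊ := by exact_mod_cast (hj.le.trans (Nat.le_ceil α))
    have : y ^ (α - (j : ℝ)) ≤ y ^ (⌈α⌉₊ - j) := by
      rw [← Real.rpow_natCast y]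
      refine Real.rpow_le_rpow_of_exponent_le h ?_
      rw [Nat.cast_sub hjc]
      linarith [Nat.le_ceil α]
    linarith

lemma prod_one_sub_sub_abs {α : ℝ} (hα : 1 < α) (j : ℕ) :
    |∏ ℓ ∈ range j, (1 - α - (ℓ : ℝ))| = ∏ ℓ ∈ range j, (α + (ℓ : ℝ) - 1) := by
  rw [abs_prod]
  refine prod_congr rfl fun ℓ _ => ?_
  have : (0 : ℝ) ≤ ℓ := ℓ.cast_nonneg
  rw [abs_of_nonpos (by linarith)]
  ring

/-- The `i`-fold primitive of the bound for the `m`-th derivative of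
`t ↦ (1 + t * u) ^ α * (1 + t * v) ^ (1 - α)` on `[0, q]`. -/
def remainderPrimitive (α : ℝ) (m : ℕ) (q u v : ℝ) (i : ℕ) (t : ℝ) : ℝ :=
  ∑ j ∈ range (m + 1),
    (1 - q) ^ (-(α + (m : ℝ) - (j : ℝ) - 1)) * (m.choose j : ℝ) *
      (∏ ℓ ∈ range j, |α - (ℓ : ℝ)|) * (∏ ℓ ∈ range (m - j), (α + (ℓ : ℝ) - 1)) *
      (if α ≤ (j : ℝ) then (t ^ i / (i.factorial : ℝ)) * ((1 - q) ^ (α - (j : ℝ)) *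
        (|u| ^ j * |v| ^ (m - j)))
       else (t ^ i / (i.factorial : ℝ)) * (|u| ^ j * |v| ^ (m - j)) +
        ∑ ℓ ∈ range (⌈α⌉₊ - j + 1), (t ^ (i + ℓ) / ((i + ℓ).factorial : ℝ)) *
          ((ℓ.factorial : ℝ) * ((⌈α⌉₊ - j).choose ℓ : ℝ) * (|u| ^ (j + ℓ) * |v| ^ (m - j))))

lemma hasDerivAt_remainderPrimitive (α : ℝ) (m : ℕ) (q u v : ℝ) (i : ℕ) (t : ℝ) :
    HasDerivAt (remainderPrimitive α m q u v (i + 1)) (remainderPrimitive α m q u v i t) t := by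
  unfold remainderPrimitive
  refine HasDerivAt.fun_sum fun j _ => HasDerivAt.const_mul _ ?_
  split_ifs
  · exact (hasDerivAt_pow_div_factorial i t).mul_const _
  · refine ((hasDerivAt_pow_div_factorial i t).mul_const _).add (HasDerivAt.fun_sum fun ℓ _ => ?_)
    rw [add_right_comm]
    exact (hasDerivAt_pow_div_factorial (i + ℓ) t).mul_const _

lemma remainderPrimitive_at_zero (α : ℝ) (m : ℕ) (q u v : ℝ) (i : ℕ) :
    remainderPrimitive α m q u v (i + 1) 0 = 0 := by
  simp [remainderPrimitive, add_right_comm i 1]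

lemma remainderPrimitive_eq_taylorRemainder (α : ℝ) (m : ℕ) (q u v : ℝ) :
    remainderPrimitive α m q u v m q =
      taylorRemainder α m q fun j ℓ => |u| ^ (j + ℓ) * |v| ^ (m - j) := by
  rw [remainderPrimitive, taylorRemainder, mul_sum]
  refine sum_congr rfl fun j _ => ?_
  refine ((mul_left_comm _ _ _).trans ?_).symm
  congr 1
  rw [mul_ite]
  refine if_congr Iff.rfl (by simp) ?_
  rw [mul_add, mul_sum]
  congr 1
  refine sum_congr rfl fun ℓ hℓ => ?_
  have hc := congrArg (Nat.cast (R := ℝ))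
    (Nat.choose_mul_factorial_mul_factorial (Nat.lt_succ_iff.1 (mem_range.1 hℓ)))
  push_cast at hc
  rw [← hc, pow_add q]
  field_simp

lemma prodDeriv_le_remainderPrimitive {α : ℝ} (hα : 1 < α) (m : ℕ) {q u v t : ℝ} (hq1 : q < 1)
    (hu : -1 < u) (hv : -1 < v) (ht : t ∈ Set.Icc 0 q) :
    prodDeriv α u v m t ≤ remainderPrimitive α m q u v 0 t := by
  have hq : 0 < 1 - q := sub_pos.2 hq1
  have hpos : ∀ w : ℝ, -1 < w → 1 - q ≤ 1 + t * w := fun w hw => by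
    nlinarith [ht.1, ht.2]
  rw [prodDeriv, Nat.sum_antidiagonal_eq_sum_range_succ_mk, remainderPrimitive]
  refine sum_le_sum fun j hj => ?_
  have hj' : j ≤ m := Nat.lt_succ_iff.1 (mem_range.1 hj)
  have hju : 0 < 1 + t * u := hq.trans_le (hpos u hu)
  have hjv : 0 < 1 + t * v := hq.trans_le (hpos v hv)
  have hp : 0 ≤ ∏ ℓ ∈ range (m - j), (α + (ℓ : ℝ) - 1) :=
    prod_nonneg fun ℓ _ => by
      have : (0 : ℝ) ≤ ℓ := ℓ.cast_nonneg
      linarith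
  have hv' : (1 + t * v) ^ (1 - α - ((m - j : ℕ) : ℝ)) ≤
      (1 - q) ^ (-(α + (m : ℝ) - (j : ℝ) - 1)) := by
    have hc : ((m - j : ℕ) : ℝ) = (m : ℝ) - j := Nat.cast_sub hj'
    have hc0 : (0 : ℝ) ≤ (m : ℝ) - j := hc ▸ Nat.cast_nonneg _
    rw [hc, show 1 - α - ((m : ℝ) - j) = -(α + (m : ℝ) - (j : ℝ) - 1) by ring]
    exact Real.rpow_le_rpow_of_nonpos hq (hpos v hv) (by linarith)
  have hu' : |u| ^ j * |v| ^ (m - j) * (1 + t * u) ^ (α - (j : ℝ)) ≤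
      if α ≤ (j : ℝ) then (t ^ 0 / (Nat.factorial 0 : ℝ)) * ((1 - q) ^ (α - (j : ℝ)) *
        (|u| ^ j * |v| ^ (m - j)))
       else (t ^ 0 / (Nat.factorial 0 : ℝ)) * (|u| ^ j * |v| ^ (m - j)) +
        ∑ ℓ ∈ range (⌈α⌉₊ - j + 1), (t ^ (0 + ℓ) / ((0 + ℓ).factorial : ℝ)) *
          ((ℓ.factorial : ℝ) * ((⌈α⌉₊ - j).choose ℓ : ℝ) * (|u| ^ (j + ℓ) * |v| ^ (m - j))) := by
    split_ifs with hαj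
    · rw [pow_zero, Nat.factorial_zero, Nat.cast_one, div_one, one_mul, mul_comm]
      exact mul_le_mul_of_nonneg_right
        (Real.rpow_le_rpow_of_nonpos hq (hpos u hu) (by linarith)) (by positivity)
    · have h1 := rpow_le_one_add_pow hju (not_le.1 hαj)
      have h2 : (1 + t * u) ^ (⌈α⌉₊ - j) ≤ (t * |u| + 1) ^ (⌈α⌉₊ - j) := by
        refine pow_le_pow_left₀ hju.le ?_ _
        have := mul_le_mul_of_nonneg_left (le_abs_self u) ht.1
        linarith
      calc _ ≤ |u| ^ j * |v| ^ (m - j) * (1 + (t * |u| + 1) ^ (⌈α⌉₊ - j)) := by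
            gcongr
            linarith
        _ = _ := by
            rw [add_pow, mul_add, mul_sum]
            congr 1
            · simp
            · refine sum_congr rfl fun ℓ _ => ?_
              rw [zero_add]
              field_simp
              ring
  have hc : 0 ≤ (m.choose j : ℝ) * (∏ ℓ ∈ range j, |α - (ℓ : ℝ)|) *
      (∏ ℓ ∈ range (m - j), (α + (ℓ : ℝ) - 1)) := by positivity
  refine (le_abs_self _).trans ?_
  have habs : |(m.choose j : ℝ) * (powDeriv α u j t * powDeriv (1 - α) v (m - j) t)| =
      (1 + t * v) ^ (1 - α - ((m - j : ℕ) : ℝ)) * ((m.choose j : ℝ) *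
        (∏ ℓ ∈ range j, |α - (ℓ : ℝ)|) * (∏ ℓ ∈ range (m - j), (α + (ℓ : ℝ) - 1))) *
        (|u| ^ j * |v| ^ (m - j) * (1 + t * u) ^ (α - (j : ℝ))) := by
    simp only [powDeriv, abs_mul, abs_pow, prod_one_sub_sub_abs hα, abs_prod, Nat.abs_cast,
      abs_of_pos (Real.rpow_pos_of_pos hju _), abs_of_pos (Real.rpow_pos_of_pos hjv _)]
    ring
  rw [habs, mul_assoc ((1 - q) ^ _), mul_assoc ((1 - q) ^ _)]
  refine mul_le_mul (mul_le_mul_of_nonneg_right hv' hc) hu' (by positivity) (by positivity)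

lemma rpow_mul_rpow_le_taylor {α : ℝ} (hα : 1 < α) (m : ℕ) {q u v : ℝ} (hq0 : 0 ≤ q) (hq1 : q < 1)
    (hu : -1 < u) (hv : -1 < v) :
    (1 + q * u) ^ α * (1 + q * v) ^ (1 - α) ≤
      ∑ k ∈ range m, q ^ k / (k.factorial : ℝ) * prodDeriv α u v k 0 +
        taylorRemainder α m q fun j ℓ => |u| ^ (j + ℓ) * |v| ^ (m - j) := by
  rw [← prodDeriv_zero, ← remainderPrimitive_eq_taylorRemainder]
  refine le_taylor_add_of_le (remainderPrimitive α m q u v)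
    (hasDerivAt_remainderPrimitive α m q u v) (remainderPrimitive_at_zero α m q u v) m
    (prodDeriv α u v) (fun i t ht => ?_)
    (fun t ht => prodDeriv_le_remainderPrimitive hα m hq1 hu hv ht) q ⟨hq0, le_rfl⟩
  exact hasDerivAt_prodDeriv α (by nlinarith [ht.1, ht.2]) (by nlinarith [ht.1, ht.2]) i

/-- The deviation `|·|` of the `j`-th coefficient in `Ftil`. -/
def coefDeviation (α : ℝ) (k j : ℕ) : ℝ :=
  α / (α - 1) * (∏ ℓ ∈ Finset.range j, (1 - (ℓ : ℝ) / α)) *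
    (∏ ℓ ∈ Finset.range (k - j), (1 + ((ℓ : ℝ) - 1) / α)) - 1

lemma prodDeriv_at_zero_eq {α : ℝ} (hα : 1 < α) (u v : ℝ) {k : ℕ} (hk : 0 < k) :
    prodDeriv α u v k 0 = (α - 1) * α ^ (k - 1) * (u - v) ^ k + (α - 1) * α ^ (k - 1) *
      ∑ j ∈ range (k + 1), (k.choose j : ℝ) * coefDeviation α k j *
        ((-1) ^ (k - j) * (u ^ j * v ^ (k - j))) := by
  have hα0 : α ≠ 0 := by linarith
  have hα1 : α - 1 ≠ 0 := by linarith
  rw [prodDeriv_at_zero, sub_eq_add_neg u v, add_pow, mul_sum, mul_sum, ← sum_add_distrib]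
  refine sum_congr rfl fun j hj => ?_
  have hj' : j ≤ k := Nat.lt_succ_iff.1 (mem_range.1 hj)
  have h1 : ∏ ℓ ∈ range j, (α - (ℓ : ℝ)) = α ^ j * ∏ ℓ ∈ range j, (1 - (ℓ : ℝ) / α) := by
    rw [pow_eq_prod_const, ← prod_mul_distrib]
    exact prod_congr rfl fun ℓ _ => by field_simp
  have h2 : ∏ ℓ ∈ range (k - j), (1 - α - (ℓ : ℝ)) =
      (-1) ^ (k - j) * α ^ (k - j) * ∏ ℓ ∈ range (k - j), (1 + ((ℓ : ℝ) - 1) / α) := by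
    rw [← mul_pow, pow_eq_prod_const, ← prod_mul_distrib]
    exact prod_congr rfl fun ℓ _ => by field_simp; ring
  have h3 : α ^ j * α ^ (k - j) = α ^ (k - 1) * α := by
    rw [← pow_add, ← pow_succ]
    congr 1
    omega
  rw [h1, h2, neg_pow v, coefDeviation]
  generalize (∏ ℓ ∈ range j, (1 - (ℓ : ℝ) / α)) = A
  generalize (∏ ℓ ∈ range (k - j), (1 + ((ℓ : ℝ) - 1) / α)) = B
  have h4 : α / (α - 1) * (α - 1) = α := div_mul_cancel₀ _ hα1
  linear_combination ((k.choose j : ℝ) * A * B * (-1) ^ (k - j) * u ^ j * v ^ (k - j)) * h3 -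
    (α ^ (k - 1) * (k.choose j : ℝ) * A * B * (-1) ^ (k - j) * u ^ j * v ^ (k - j)) * h4

lemma prodDeriv_at_zero_le {α : ℝ} (hα : 1 < α) (u v : ℝ) {k : ℕ} (hk : 0 < k) :
    prodDeriv α u v k 0 ≤ (α - 1) * α ^ (k - 1) * (u - v) ^ k + (α - 1) * α ^ (k - 1) *
      ∑ j ∈ range (k + 1), (k.choose j : ℝ) * |coefDeviation α k j| *
        (|u| ^ j * |v| ^ (k - j)) := by
  rw [prodDeriv_at_zero_eq hα u v hk]
  have : 0 < α - 1 := sub_pos.2 hα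
  have : 0 < α := by linarith
  refine add_le_add le_rfl (mul_le_mul_of_nonneg_left (sum_le_sum fun j _ => ?_) (by positivity))
  refine (le_abs_self _).trans_eq ?_
  simp [abs_mul, abs_pow]

lemma prodDeriv_at_zero_one (α u v : ℝ) : prodDeriv α u v 1 0 = α * u + (1 - α) * v := by
  rw [prodDeriv_at_zero]
  simp [sum_range_succ]
  ring

lemma prodDeriv_at_zero_two (α u v : ℝ) :
    prodDeriv α u v 2 0 = α * (α - 1) * (u - v) ^ 2 := by
  rw [prodDeriv_at_zero]
  simp [sum_range_succ, prod_range_succ]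
  ring

/-! ### One-step bound -/

/-- The argument of the logarithm in the one-step Rényi bound. -/
def stepBound (α σ : ℝ) (m : ℕ) (q : ℝ) : ℝ :=
  1 + q ^ 2 * (α * (α - 1)) * (Real.exp (4 / σ ^ 2) - Real.exp (2 / σ ^ 2)) +
    (∑ j ∈ Finset.Icc 3 (m - 1), q ^ j / (j.factorial : ℝ) * Ftil α σ j) + Etil α σ m q

lemma Btil_nonneg {σ : ℝ} (hσ : 0 < σ) (k : ℕ) : 0 ≤ Btil σ k :=
  (integral_nonneg fun x => by positivity).trans
    (integral_abs_likRatio_sub_one_pow_le_Btil (a := (0 : ℝ)) (c := 0) (s := 1) one_pos hσ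
      (by simp; positivity) k)

lemma Ftil_nonneg {α σ : ℝ} (hα : 1 < α) (hσ : 0 < σ) (k : ℕ) : 0 ≤ Ftil α σ k := by
  have h1 : 0 < α - 1 := sub_pos.2 hα
  have h0 : 0 < α := by linarith
  have hB := Btil_nonneg hσ k
  unfold Ftil
  refine add_nonneg (mul_nonneg (by positivity) ?_) (by positivity)
  split_ifs with hk
  · rw [Btil, if_pos hk] at hB
    positivity
  · positivity

lemma Etil_nonneg {α σ : ℝ} (hα : 1 < α) (hσ : 0 < σ) (m : ℕ) {q : ℝ} (hq0 : 0 ≤ q)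
    (hq1 : q < 1) : 0 ≤ Etil α σ m q := by
  rw [Etil_eq_taylorRemainder, ← taylorRemainder_zero α m q]
  exact taylorRemainder_mono hα m hq0 hq1 fun _ _ _ => Btil_nonneg hσ _

lemma one_le_stepBound {α σ : ℝ} (hα : 1 < α) (hσ : 0 < σ) (m : ℕ) {q : ℝ} (hq0 : 0 ≤ q)
    (hq1 : q < 1) : 1 ≤ stepBound α σ m q := by
  have h1 : 0 ≤ q ^ 2 * (α * (α - 1)) * (Real.exp (4 / σ ^ 2) - Real.exp (2 / σ ^ 2)) := by
    have h2 : Real.exp (2 / σ ^ 2) ≤ Real.exp (4 / σ ^ 2) := by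
      gcongr
      norm_num
    have : 0 < α - 1 := sub_pos.2 hα
    have : 0 < α := by linarith
    have := sub_nonneg.2 h2
    positivity
  have h2 : 0 ≤ ∑ j ∈ Finset.Icc 3 (m - 1), q ^ j / (j.factorial : ℝ) * Ftil α σ j :=
    sum_nonneg fun j _ => mul_nonneg (by positivity) (Ftil_nonneg hα hσ j)
  have h3 := Etil_nonneg hα hσ m hq0 hq1
  unfold stepBound
  linarith

lemma integrable_taylorRemainder (α : ℝ) (m : ℕ) (q : ℝ) {Ω : Type*}
    [MeasurableSpace Ω] {μ : Measure Ω} {W : Ω → ℕ → ℕ → ℝ}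
    (hW : ∀ j ℓ, Integrable (fun x => W x j ℓ) μ) :
    Integrable (fun x => taylorRemainder α m q (W x)) μ := by
  unfold taylorRemainder
  refine (integrable_finsetSum _ fun j _ => Integrable.const_mul ?_ _).const_mul _
  split_ifs
  · exact (hW j 0).const_mul _
  · exact (hW j 0).add (integrable_finsetSum _ fun ℓ _ => (hW j ℓ).const_mul _)

lemma integral_taylorRemainder (α : ℝ) (m : ℕ) (q : ℝ) {Ω : Type*}
    [MeasurableSpace Ω] {μ : Measure Ω} {W : Ω → ℕ → ℕ → ℝ}
    (hW : ∀ j ℓ, Integrable (fun x => W x j ℓ) μ) :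
    ∫ x, taylorRemainder α m q (W x) ∂μ = taylorRemainder α m q fun j ℓ => ∫ x, W x j ℓ ∂μ := by
  unfold taylorRemainder
  rw [integral_const_mul, integral_finsetSum]
  · congr 1
    refine sum_congr rfl fun j _ => ?_
    rw [integral_const_mul]
    congr 1
    split_ifs
    · rw [integral_const_mul]
    · rw [integral_add (hW j 0) (integrable_finsetSum _ fun ℓ _ => (hW j ℓ).const_mul _),
        integral_finsetSum _ fun ℓ _ => (hW j ℓ).const_mul _]
      simp_rw [integral_const_mul]
  · intro j _
    refine Integrable.const_mul ?_ _
    split_ifs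
    · exact (hW j 0).const_mul _
    · exact (hW j 0).add (integrable_finsetSum _ fun ℓ _ => (hW j ℓ).const_mul _)

section OneStep

variable {V : Type*} [NormedAddCommGroup V] [InnerProductSpace ℝ V] [MeasurableSpace V]
  [BorelSpace V] [FiniteDimensional ℝ V]

lemma integrable_prodDeriv_at_zero (α : ℝ) (a b c : V) {s : ℝ} (hs : 0 < s) (k : ℕ) :
    Integrable (fun x => prodDeriv α (likRatio a c s x - 1) (likRatio b c s x - 1) k 0)
      (gaussMeasure c s) := by
  simp_rw [prodDeriv_at_zero]
  refine integrable_finsetSum _ fun j _ => Integrable.const_mul ?_ _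
  refine (integrable_abs_pow_mul_abs_pow a b c hs j (k - j)).mono ?_
    (Filter.Eventually.of_forall fun x => by simp)
  have h1 := continuous_likRatio a c hs
  have h2 := continuous_likRatio b c hs
  exact Continuous.aestronglyMeasurable (by fun_prop)

lemma integral_prodDeriv_at_zero_le_Ftil {α : ℝ} (hα : 1 < α) {a b c : V} {s σ : ℝ} (hs : 0 < s)
    (hσ : 0 < σ) (hac : ‖a - c‖ ^ 2 / s ^ 2 ≤ 4 / σ ^ 2) (hbc : ‖b - c‖ ^ 2 / s ^ 2 ≤ 4 / σ ^ 2)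
    (hab : ‖a - b‖ ^ 2 / s ^ 2 ≤ 4 / σ ^ 2) {k : ℕ} (hk : 0 < k) :
    ∫ x, prodDeriv α (likRatio a c s x - 1) (likRatio b c s x - 1) k 0 ∂(gaussMeasure c s) ≤
      Ftil α σ k := by
  have h1 : 0 < α - 1 := sub_pos.2 hα
  have h0 : 0 < α := by linarith
  have hI1 := (integrable_likRatio_sub_likRatio_pow a b c hs k).const_mul
    ((α - 1) * α ^ (k - 1))
  have hI2 := fun j => (integrable_abs_pow_mul_abs_pow a b c hs j (k - j)).const_mul
    ((k.choose j : ℝ) * |coefDeviation α k j|)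
  have hI3 := (integrable_finsetSum (range (k + 1)) fun j _ => hI2 j).const_mul
    ((α - 1) * α ^ (k - 1))
  refine (integral_mono (integrable_prodDeriv_at_zero α a b c hs k) (hI1.add hI3) fun x => ?_).trans
    (?_ : ∫ x, ((α - 1) * α ^ (k - 1) * (likRatio a c s x - likRatio b c s x) ^ k +
      (α - 1) * α ^ (k - 1) * ∑ j ∈ range (k + 1), (k.choose j : ℝ) * |coefDeviation α k j| *
        (|likRatio a c s x - 1| ^ j * |likRatio b c s x - 1| ^ (k - j))) ∂(gaussMeasure c s) ≤ _)
  · have := prodDeriv_at_zero_le hα (likRatio a c s x - 1) (likRatio b c s x - 1) hk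
    rwa [sub_sub_sub_cancel_right] at this
  · rw [integral_add hI1 hI3, integral_const_mul, integral_const_mul,
      integral_finsetSum _ fun j _ => hI2 j]
    unfold Ftil
    refine add_le_add (mul_le_mul_of_nonneg_left
      (integral_likRatio_sub_likRatio_pow_le hs hσ hac hbc hab hk) (by positivity))
      (mul_le_mul_of_nonneg_left (sum_le_sum fun j hj => ?_) (by positivity))
    rw [integral_const_mul]
    refine mul_le_mul_of_nonneg_left ?_ (by positivity)
    have hjk : j + (k - j) = k := Nat.add_sub_cancel' (Nat.lt_succ_iff.1 (mem_range.1 hj))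
    have := integral_abs_pow_mul_abs_pow_le_Btil hs hσ hac hbc (i := j) (j := k - j) (by omega)
    rwa [hjk] at this

/-- Integrable domination of the order-`α` integrand for two mixtures sharing the component `c`. -/
lemma exists_integrable_dominating {α : ℝ} (hα : 1 < α) {a b c : V} {s σ : ℝ} (hs : 0 < s)
    (hσ : 0 < σ) (hac : ‖a - c‖ ^ 2 / s ^ 2 ≤ 4 / σ ^ 2) (hbc : ‖b - c‖ ^ 2 / s ^ 2 ≤ 4 / σ ^ 2)
    (hab : ‖a - b‖ ^ 2 / s ^ 2 ≤ 4 / σ ^ 2) {m : ℕ} (hm : 3 ≤ m) {q : ℝ} (hq0 : 0 ≤ q)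
    (hq1 : q < 1) :
    ∃ G : V → ℝ, Integrable G ∧
      (∀ x, ((q * gaussV a s x + (1 - q) * gaussV c s x) /
        (q * gaussV b s x + (1 - q) * gaussV c s x)) ^ α *
        (q * gaussV b s x + (1 - q) * gaussV c s x) ≤ G x) ∧
      ∫ x, G x ≤ stepBound α σ m q := by
  have hprob := isProbabilityMeasure_gaussMeasure c hs
  set u : V → ℝ := fun x => likRatio a c s x - 1 with hu
  set v : V → ℝ := fun x => likRatio b c s x - 1 with hv
  have hI1 := fun k => (integrable_prodDeriv_at_zero α a b c hs k).const_mul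
    (q ^ k / (k.factorial : ℝ))
  have hI2 := fun j ℓ => integrable_abs_pow_mul_abs_pow a b c hs (j + ℓ) (m - j)
  have hIs := integrable_finsetSum (range m) fun k _ => hI1 k
  have hIr := integrable_taylorRemainder α m q hI2
  refine ⟨fun x => gaussV c s x * (∑ k ∈ range m, q ^ k / (k.factorial : ℝ) *
    prodDeriv α (u x) (v x) k 0 +
      taylorRemainder α m q fun j ℓ => |u x| ^ (j + ℓ) * |v x| ^ (m - j)),
    (integrable_gaussMeasure_iff c hs _).1 (hIs.add hIr), fun x => ?_, ?_⟩
  · have hux : -1 < u x := by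
      have := likRatio_pos a c hs x
      simp only [hu]; linarith
    have hvx : -1 < v x := by
      have := likRatio_pos b c hs x
      simp only [hv]; linarith
    have h1 : 0 < 1 + q * u x := by nlinarith
    have h2 : 0 < 1 + q * v x := by nlinarith
    have hc := gaussV_pos c hs x
    have e1 : q * gaussV a s x + (1 - q) * gaussV c s x = gaussV c s x * (1 + q * u x) := by
      rw [← gaussV_mul_likRatio a c hs x]; simp only [hu]; ring
    have e2 : q * gaussV b s x + (1 - q) * gaussV c s x = gaussV c s x * (1 + q * v x) := by
      rw [← gaussV_mul_likRatio b c hs x]; simp only [hv]; ring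
    rw [e1, e2, mul_div_mul_left _ _ hc.ne', Real.div_rpow h1.le h2.le]
    calc _ = gaussV c s x * ((1 + q * u x) ^ α * (1 + q * v x) ^ (1 - α)) := by
          rw [Real.rpow_sub h2, Real.rpow_one]
          field_simp
      _ ≤ _ := by
          exact mul_le_mul_of_nonneg_left (rpow_mul_rpow_le_taylor hα m hq0 hq1 hux hvx) hc.le
  · rw [← integral_gaussMeasure c hs, integral_add hIs hIr, integral_taylorRemainder α m q hI2,
      integral_finsetSum _ fun k _ => hI1 k]
    unfold stepBound
    refine add_le_add ?_ ?_
    · simp_rw [integral_const_mul]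
      rw [range_eq_Ico, ← sum_Ico_consecutive _ (Nat.zero_le 3) hm,
        show Icc 3 (m - 1) = Ico 3 m by ext; simp; omega]
      refine add_le_add ?_ (sum_le_sum fun k hk => mul_le_mul_of_nonneg_left
        (integral_prodDeriv_at_zero_le_Ftil hα hs hσ hac hbc hab
          (by have := (mem_Ico.1 hk).1; omega)) (by positivity))
      have i0 : ∫ x, prodDeriv α (u x) (v x) 0 0 ∂(gaussMeasure c s) = 1 := by
        simp [prodDeriv_zero]
      have i1 : ∫ x, prodDeriv α (u x) (v x) 1 0 ∂(gaussMeasure c s) = 0 := by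
        have hu1 := integrable_likRatio_sub_one_pow a c hs 1
        have hv1 := integrable_likRatio_sub_one_pow b c hs 1
        simp only [pow_one] at hu1 hv1
        simp_rw [prodDeriv_at_zero_one]
        rw [integral_add (hu1.const_mul α) (hv1.const_mul (1 - α)), integral_const_mul,
          integral_const_mul, integral_likRatio_sub_one a c hs, integral_likRatio_sub_one b c hs]
        simp
      have i2 : ∫ x, prodDeriv α (u x) (v x) 2 0 ∂(gaussMeasure c s) ≤
          α * (α - 1) * (2 * (Real.exp (4 / σ ^ 2) - Real.exp (2 / σ ^ 2))) := by
        simp_rw [prodDeriv_at_zero_two, hu, hv, sub_sub_sub_cancel_right]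
        rw [integral_const_mul]
        exact mul_le_mul_of_nonneg_left (integral_likRatio_sub_likRatio_sq_le hs hac hbc hab)
          (mul_nonneg (by linarith) (by linarith))
      have i2' := mul_le_mul_of_nonneg_left i2 (show 0 ≤ q ^ 2 / 2 by positivity)
      simp only [← range_eq_Ico, sum_range_succ, range_zero, sum_empty]
      rw [i0, i1]
      norm_num [Nat.factorial]
      linarith
    · rw [Etil_eq_taylorRemainder]
      refine taylorRemainder_mono hα m hq0 hq1 fun j hj ℓ => ?_
      have := integral_abs_pow_mul_abs_pow_le_Btil hs hσ hac hbc (i := j + ℓ) (j := m - j)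
        (by omega)
      rwa [show j + ℓ + (m - j) = ℓ + m by omega] at this

/-- Joint convexity of `(P, Q) ↦ (P / Q) ^ α * Q` for finite convex combinations. -/
lemma rpow_div_mul_sum_le {ι : Type*} (t : Finset ι) (ht : t.Nonempty) {w P Q : ι → ℝ} {α : ℝ}
    (hα : 1 ≤ α) (hw : ∀ i ∈ t, 0 < w i) (hP : ∀ i ∈ t, 0 ≤ P i) (hQ : ∀ i ∈ t, 0 < Q i) :
    ((∑ i ∈ t, w i * P i) / ∑ i ∈ t, w i * Q i) ^ α * ∑ i ∈ t, w i * Q i ≤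
      ∑ i ∈ t, w i * ((P i / Q i) ^ α * Q i) := by
  set S := ∑ i ∈ t, w i * Q i with hS
  have hSpos : 0 < S := sum_pos (fun i hi => mul_pos (hw i hi) (hQ i hi)) ht
  have h := (convexOn_rpow hα).map_sum_le (t := t) (w := fun i => w i * Q i / S)
    (p := fun i => P i / Q i)
    (fun i hi => div_nonneg (mul_nonneg (hw i hi).le (hQ i hi).le) hSpos.le)
    (by rw [← sum_div, div_self hSpos.ne'])
    (fun i hi => Set.mem_Ici.2 (div_nonneg (hP i hi) (hQ i hi).le))
  simp only [smul_eq_mul] at h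
  have e : ∑ i ∈ t, w i * Q i / S * (P i / Q i) = (∑ i ∈ t, w i * P i) / S := by
    rw [sum_div]
    refine sum_congr rfl fun i hi => ?_
    have := (hQ i hi).ne'
    field_simp
  rw [e] at h
  calc _ ≤ (∑ i ∈ t, w i * Q i / S * (P i / Q i) ^ α) * S :=
        mul_le_mul_of_nonneg_right h hSpos.le
    _ = _ := by
        rw [sum_mul]
        refine sum_congr rfl fun i _ => ?_
        field_simp

lemma lintegral_mixture_le {ι : Type*} (t : Finset ι) {w : ι → ℝ} {a b c : ι → V} {α s σ : ℝ}
    (hα : 1 < α) (hs : 0 < s) (hσ : 0 < σ) (hw : ∀ i ∈ t, 0 < w i) (hw1 : ∑ i ∈ t, w i = 1)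
    (hac : ∀ i ∈ t, ‖a i - c i‖ ^ 2 / s ^ 2 ≤ 4 / σ ^ 2)
    (hbc : ∀ i ∈ t, ‖b i - c i‖ ^ 2 / s ^ 2 ≤ 4 / σ ^ 2)
    (hab : ∀ i ∈ t, ‖a i - b i‖ ^ 2 / s ^ 2 ≤ 4 / σ ^ 2) {m : ℕ} (hm : 3 ≤ m) {q : ℝ}
    (hq0 : 0 ≤ q) (hq1 : q < 1) {P Q : V → ℝ}
    (hP : ∀ x, P x = ∑ i ∈ t, w i * (q * gaussV (a i) s x + (1 - q) * gaussV (c i) s x))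
    (hQ : ∀ x, Q x = ∑ i ∈ t, w i * (q * gaussV (b i) s x + (1 - q) * gaussV (c i) s x)) :
    ∫⁻ x, ENNReal.ofReal ((P x / Q x) ^ α * Q x) ≤ ENNReal.ofReal (stepBound α σ m q) := by
  have ht : t.Nonempty := by
    rw [nonempty_iff_ne_empty]
    rintro rfl
    simp at hw1
  have hpos : ∀ (a c : V) x, 0 < q * gaussV a s x + (1 - q) * gaussV c s x := fun a c x => by
    have h1 := gaussV_pos a hs x
    have h2 := gaussV_pos c hs x
    have h3 := sub_pos.2 hq1
    positivity
  choose! G hGi hGle hGint using fun i hi =>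
    exists_integrable_dominating hα hs hσ (hac i hi) (hbc i hi) (hab i hi) hm hq0 hq1
  have hle : ∀ x, (P x / Q x) ^ α * Q x ≤ ∑ i ∈ t, w i * G i x := fun x => by
    rw [hP, hQ]
    exact (rpow_div_mul_sum_le t ht hα.le hw (fun i _ => (hpos _ _ x).le)
      fun i _ => hpos _ _ x).trans
      (sum_le_sum fun i hi => mul_le_mul_of_nonneg_left (hGle i hi x) (hw i hi).le)
  have hnn : ∀ x, 0 ≤ (P x / Q x) ^ α * Q x := fun x => by
    have hP0 : 0 ≤ P x := hP x ▸ sum_nonneg fun i hi => mul_nonneg (hw i hi).le (hpos _ _ x).le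
    have hQ0 : 0 ≤ Q x := hQ x ▸ sum_nonneg fun i hi => mul_nonneg (hw i hi).le (hpos _ _ x).le
    positivity
  have hGI : ∀ i ∈ t, Integrable fun x => w i * G i x := fun i hi => (hGi i hi).const_mul _
  calc _ ≤ ∫⁻ x, ENNReal.ofReal (∑ i ∈ t, w i * G i x) :=
        lintegral_mono fun x => ENNReal.ofReal_le_ofReal (hle x)
    _ = ENNReal.ofReal (∫ x, ∑ i ∈ t, w i * G i x) :=
        (ofReal_integral_eq_lintegral_ofReal (integrable_finsetSum _ hGI)
          (Filter.Eventually.of_forall fun x => (hnn x).trans (hle x))).symm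
    _ ≤ _ := by
        refine ENNReal.ofReal_le_ofReal ?_
        rw [integral_finsetSum _ hGI]
        calc _ ≤ ∑ i ∈ t, w i * stepBound α σ m q := sum_le_sum fun i hi => by
              rw [integral_const_mul]
              exact mul_le_mul_of_nonneg_left (hGint i hi) (hw i hi).le
          _ = _ := by rw [← sum_mul, hw1, one_mul]

end OneStep

/-! ### Replace-one coupling of fixed-size batches -/

section Coupling

variable {n : ℕ}

/-- Pairs of a batch of size `k` containing `i` and an index outside of that batch. -/
def swapPairs (k : ℕ) (i : Fin n) : Finset (Σ _ : Finset (Fin n), Fin n) :=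
  ((powersetCard k univ).filter (i ∈ ·)).sigma fun b => bᶜ

lemma mem_swapPairs {k : ℕ} {i : Fin n} {p : Σ _ : Finset (Fin n), Fin n} :
    p ∈ swapPairs k i ↔ (p.1.card = k ∧ i ∈ p.1) ∧ p.2 ∉ p.1 := by
  simp [swapPairs, mem_powersetCard]

lemma sum_swapPairs_fst {k : ℕ} (hkn : k ≤ n) (i : Fin n) (f : Finset (Fin n) → ℝ) :
    ∑ p ∈ swapPairs k i, f p.1 =
      ((n : ℝ) - k) * ∑ b ∈ (powersetCard k univ).filter (i ∈ ·), f b := by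
  rw [swapPairs, sum_sigma, mul_sum]
  refine sum_congr rfl fun b hb => ?_
  have hb' : b.card = k := (mem_powersetCard.1 (mem_filter.1 hb).1).2
  simp only [sum_const, card_compl, hb', Fintype.card_fin, nsmul_eq_mul, Nat.cast_sub hkn]

lemma sum_swapPairs_swap (k : ℕ) (i : Fin n) (f : Finset (Fin n) → ℝ) :
    ∑ p ∈ swapPairs k i, f (insert p.2 (p.1.erase i)) =
      k * ∑ b ∈ (powersetCard k univ).filter (i ∉ ·), f b := by
  have h : ∑ p ∈ swapPairs k i, f (insert p.2 (p.1.erase i)) =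
      ∑ p ∈ ((powersetCard k univ).filter (i ∉ ·)).sigma fun b => b, f p.1 := by
    refine sum_bij' (fun p _ => (⟨insert p.2 (p.1.erase i), p.2⟩ : Σ _ : Finset (Fin n), Fin n))
      (fun p _ => (⟨insert i (p.1.erase p.2), p.2⟩ : Σ _ : Finset (Fin n), Fin n))
      ?_ ?_ ?_ ?_ fun _ _ => rfl
    · rintro ⟨b, j⟩ hp
      obtain ⟨⟨hb, hi⟩, hj⟩ := mem_swapPairs.1 hp
      have hij : i ≠ j := fun h => hj (h ▸ hi)
      have hjb : j ∉ b.erase i := fun h => hj (mem_of_mem_erase h)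
      have : 0 < b.card := card_pos.2 ⟨i, hi⟩
      simp only [mem_sigma, mem_filter, mem_powersetCard, subset_univ, true_and,
        card_insert_of_notMem hjb, card_erase_of_mem hi, mem_insert, mem_erase]
      simp only at hb
      simp [hij]
      omega
    · rintro ⟨b, j⟩ hp
      simp only [mem_sigma, mem_filter, mem_powersetCard, subset_univ, true_and] at hp
      obtain ⟨⟨hb, hi⟩, hj⟩ := hp
      have hij : j ≠ i := fun h => hi (h ▸ hj)
      have hib : i ∉ b.erase j := fun h => hi (mem_of_mem_erase h)
      have : 0 < b.card := card_pos.2 ⟨j, hj⟩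
      simp only [mem_swapPairs, card_insert_of_notMem hib, card_erase_of_mem hj, mem_insert,
        mem_erase]
      simp [hij]
      omega
    · rintro ⟨b, j⟩ hp
      obtain ⟨⟨hb, hi⟩, hj⟩ := mem_swapPairs.1 hp
      have hjb : j ∉ b.erase i := fun h => hj (mem_of_mem_erase h)
      simp only at hi
      simp [erase_insert hjb, insert_erase hi]
    · rintro ⟨b, j⟩ hp
      simp only [mem_sigma, mem_filter, mem_powersetCard, subset_univ, true_and] at hp
      obtain ⟨⟨hb, hi⟩, hj⟩ := hp
      have hib : i ∉ b.erase j := fun h => hi (mem_of_mem_erase h)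
      simp [erase_insert hib, insert_erase hj]
  rw [h, sum_sigma, mul_sum]
  refine sum_congr rfl fun b hb => ?_
  simp only [sum_const, (mem_powersetCard.1 (mem_filter.1 hb).1).2, nsmul_eq_mul]

/-- The uniform average over batches of size `k` as a mixture over `swapPairs`. -/
lemma average_eq_sum_swapPairs {k : ℕ} (hk : 0 < k) (hkn : k < n) (i : Fin n)
    (f : Finset (Fin n) → ℝ) :
    ((n.choose k : ℝ))⁻¹ * ∑ b ∈ powersetCard k univ, f b =
      ∑ p ∈ swapPairs k i, (n : ℝ) / (k * (n - k) * n.choose k) *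
        ((k : ℝ) / n * f p.1 + (1 - (k : ℝ) / n) * f (insert p.2 (p.1.erase i))) := by
  have hk0 : (k : ℝ) ≠ 0 := by positivity
  have hn0 : (n : ℝ) ≠ 0 := by have := hk.trans hkn; positivity
  have hnk : (n : ℝ) - k ≠ 0 := sub_ne_zero.2 (by exact_mod_cast hkn.ne')
  have hc : (n.choose k : ℝ) ≠ 0 := by exact_mod_cast (Nat.choose_pos hkn.le).ne'
  rw [← mul_sum, sum_add_distrib, ← mul_sum, ← mul_sum, sum_swapPairs_fst hkn.le,
    sum_swapPairs_swap, ← sum_filter_add_sum_filter_not (powersetCard k univ) (i ∈ ·)]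
  field_simp

lemma sum_swapPairs_weight {k : ℕ} (hk : 0 < k) (hkn : k < n) (i : Fin n) :
    ∑ _p ∈ swapPairs k i, (n : ℝ) / (k * (n - k) * n.choose k) = 1 := by
  have h := average_eq_sum_swapPairs hk hkn i fun _ => 1
  have hc : (n.choose k : ℝ) ≠ 0 := by exact_mod_cast (Nat.choose_pos hkn.le).ne'
  simpa [hc] using h.symm

end Coupling

lemma norm_clip_le {E : Type*} [NormedAddCommGroup E] [NormedSpace ℝ E] {C : ℝ} (hC : 0 < C)
    (x : E) : ‖clip C x‖ ≤ C := by
  have h1 : 0 < max 1 (‖x‖ / C) := one_pos.trans_le (le_max_left _ _)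
  rw [clip, norm_smul, norm_inv, Real.norm_of_nonneg h1.le, inv_mul_le_iff₀ h1]
  exact (div_le_iff₀ hC).1 (le_max_right _ _)

section Transition

variable {X : Type*} {p n : ℕ} {g : EuclideanSpace ℝ (Fin p) → X → EuclideanSpace ℝ (Fin p)}

lemma muStep_insert (C η : ℝ) (k : ℕ) (θ : EuclideanSpace ℝ (Fin p)) {b : Finset (Fin n)}
    {j : Fin n} (hj : j ∉ b) (D : Fin n → X) :
    muStep C η k g θ (insert j b) D =
      muStep C η k g θ b D - (η / (k : ℝ)) • clip C (g θ (D j)) := by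
  rw [muStep, muStep, sum_insert hj, smul_add]
  abel

lemma muStep_congr (C η : ℝ) (k : ℕ) (θ : EuclideanSpace ℝ (Fin p)) {b : Finset (Fin n)}
    {D D' : Fin n → X} (h : ∀ j ∈ b, D j = D' j) :
    muStep C η k g θ b D = muStep C η k g θ b D' := by
  rw [muStep, muStep, sum_congr rfl fun j hj => by rw [h j hj]]

lemma norm_sq_sub_clip_div_le {E : Type*} [NormedAddCommGroup E] [NormedSpace ℝ E] {C η σ κ : ℝ}
    (hC : 0 < C) (hη : 0 < η) (hσ : 0 < σ) (hκ : 0 < κ) (z x y : E) :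
    ‖(z - (η / κ) • clip C x) - (z - (η / κ) • clip C y)‖ ^ 2 / (C * η * σ / κ) ^ 2 ≤
      4 / σ ^ 2 := by
  have h : ‖(z - (η / κ) • clip C x) - (z - (η / κ) • clip C y)‖ ≤ η / κ * (C + C) := by
    rw [sub_sub_sub_cancel_left, ← smul_sub, norm_smul, Real.norm_of_nonneg (by positivity)]
    gcongr
    exact (norm_sub_le _ _).trans (add_le_add (norm_clip_le hC y) (norm_clip_le hC x))
  calc _ ≤ (η / κ * (C + C)) ^ 2 / (C * η * σ / κ) ^ 2 := by gcongr
    _ = _ := by field_simp; ring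

lemma pFSwoR_pos {C η σ : ℝ} (hC : 0 < C) (hη : 0 < η) (hσ : 0 < σ) {k : ℕ} (hk : 0 < k)
    (hkn : k ≤ n) (D : Fin n → X) (θ θ' : EuclideanSpace ℝ (Fin p)) :
    0 < pFSwoR C η σ k g n D θ θ' := by
  have hc : (0 : ℝ) < n.choose k := by exact_mod_cast Nat.choose_pos hkn
  refine mul_pos (inv_pos.2 hc) (sum_pos (fun b _ => ?_) (powersetCard_nonempty.2 (by simpa)))
  rw [gaussND_eq_gaussV]
  exact gaussV_pos _ (by positivity) _

lemma lintegral_pFSwoR_le {C η σ : ℝ} (hC : 0 < C) (hη : 0 < η) (hσ : 0 < σ) {k : ℕ} (hk : 0 < k)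
    (hkn : k < n) {D D' : Fin n → X} (hadj : AdjReplaceOne D D') {α : ℝ} (hα : 1 < α) {m : ℕ}
    (hm : 3 ≤ m) (θ : EuclideanSpace ℝ (Fin p)) :
    ∫⁻ θ', ENNReal.ofReal ((pFSwoR C η σ k g n D θ θ' / pFSwoR C η σ k g n D' θ θ') ^ α *
      pFSwoR C η σ k g n D' θ θ') ≤ ENNReal.ofReal (stepBound α σ m ((k : ℝ) / n)) := by
  obtain ⟨i, -, hD⟩ := hadj
  have hk0 : (0 : ℝ) < k := by positivity
  have hn0 : (0 : ℝ) < n := by have := hk.trans hkn; positivity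
  have hnk : (0 : ℝ) < n - k := sub_pos.2 (by exact_mod_cast hkn)
  have hc : (0 : ℝ) < n.choose k := by exact_mod_cast Nat.choose_pos hkn.le
  have hmu : ∀ D : Fin n → X, ∀ q ∈ swapPairs k i, muStep C η k g θ q.1 D =
      muStep C η k g θ (q.1.erase i) D - (η / (k : ℝ)) • clip C (g θ (D i)) := fun D q hq => by
    rw [← muStep_insert C η k θ (notMem_erase i q.1), insert_erase (mem_swapPairs.1 hq).1.2]
  have hmu' : ∀ D : Fin n → X, ∀ q ∈ swapPairs k i, muStep C η k g θ (insert q.2 (q.1.erase i)) D =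
      muStep C η k g θ (q.1.erase i) D - (η / (k : ℝ)) • clip C (g θ (D q.2)) := fun D q hq =>
    muStep_insert C η k θ (fun h => (mem_swapPairs.1 hq).2 (mem_of_mem_erase h)) D
  have hrest : ∀ q ∈ swapPairs k i, muStep C η k g θ (q.1.erase i) D' =
      muStep C η k g θ (q.1.erase i) D := fun q _ =>
    muStep_congr C η k θ fun j hj => (hD j (ne_of_mem_erase hj)).symm
  have hswap : ∀ q ∈ swapPairs k i, muStep C η k g θ (insert q.2 (q.1.erase i)) D' =
      muStep C η k g θ (insert q.2 (q.1.erase i)) D := fun q hq => by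
    have hne : q.2 ≠ i := fun h => (mem_swapPairs.1 hq).2 (h ▸ (mem_swapPairs.1 hq).1.2)
    rw [hmu' D q hq, hmu' D' q hq, hrest q hq, hD q.2 hne]
  refine lintegral_mixture_le (swapPairs k i) (s := C * η * σ / k)
    (w := fun _ => (n : ℝ) / (k * (n - k) * n.choose k))
    (a := fun q => muStep C η k g θ q.1 D) (b := fun q => muStep C η k g θ q.1 D')
    (c := fun q => muStep C η k g θ (insert q.2 (q.1.erase i)) D)
    hα (by positivity) hσ (fun _ _ => by positivity) (sum_swapPairs_weight hk hkn i)
    (fun q hq => ?_) (fun q hq => ?_) (fun q hq => ?_) hm (by positivity)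
    ((div_lt_one hn0).2 (by exact_mod_cast hkn)) (fun x => ?_) (fun x => ?_)
  · rw [hmu D q hq, hmu' D q hq]
    exact norm_sq_sub_clip_div_le hC hη hσ hk0 _ _ _
  · rw [hmu D' q hq, hmu' D q hq, hrest q hq]
    exact norm_sq_sub_clip_div_le hC hη hσ hk0 _ _ _
  · rw [hmu D q hq, hmu D' q hq, hrest q hq]
    exact norm_sq_sub_clip_div_le hC hη hσ hk0 _ _ _
  · simp only [pFSwoR, gaussND_eq_gaussV]
    exact average_eq_sum_swapPairs hk hkn i _
  · simp only [pFSwoR, gaussND_eq_gaussV]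
    rw [average_eq_sum_swapPairs hk hkn i]
    exact sum_congr rfl fun q hq => by rw [hswap q hq]

end Transition

/-! ### Composition along the chain -/

section Chain

variable {E : Type*}

lemma chainDensity_cons (T : ℕ) (r : ℕ → E → E → ℝ) (θ₀ y : E) (x : Fin T → E) :
    chainDensity (T + 1) r θ₀ (Fin.cons y x : Fin (T + 1) → E) =
      r 0 θ₀ y * chainDensity T (fun t => r (t + 1)) y x := by
  rw [chainDensity, Fin.prod_univ_succ, chainDensity]
  congr 1
  refine prod_congr rfl fun t _ => ?_
  obtain ⟨_ | t, ht⟩ := t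
  · rfl
  · rfl

lemma chainDensity_pos {T : ℕ} {r : ℕ → E → E → ℝ} (hr : ∀ t < T, ∀ x y, 0 < r t x y) (θ₀ : E)
    (x : Fin T → E) : 0 < chainDensity T r θ₀ x :=
  prod_pos fun t _ => hr t t.isLt _ _

variable [MeasureSpace E] [SigmaFinite (volume : Measure E)]

lemma lintegral_chainDensity_le {α : ℝ} (T : ℕ) {P Q : ℕ → E → E → ℝ} {B : ℕ → ℝ}
    (hP : ∀ t < T, ∀ x y, 0 < P t x y) (hQ : ∀ t < T, ∀ x y, 0 < Q t x y)
    (hB : ∀ t < T, ∀ x, ∫⁻ y, ENNReal.ofReal ((P t x y / Q t x y) ^ α * Q t x y) ≤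
      ENNReal.ofReal (B t)) (θ₀ : E) :
    ∫⁻ x, ENNReal.ofReal ((chainDensity T P θ₀ x / chainDensity T Q θ₀ x) ^ α *
      chainDensity T Q θ₀ x) ≤ ∏ t ∈ range T, ENNReal.ofReal (B t) := by
  induction T generalizing P Q B θ₀ with
  | zero => simp [chainDensity, volume_pi]
  | succ T ih =>
    have hstep := fun y => ih (P := fun t => P (t + 1)) (Q := fun t => Q (t + 1))
      (B := fun t => B (t + 1)) (fun t ht => hP _ (by omega)) (fun t ht => hQ _ (by omega))
      (fun t ht => hB _ (by omega)) y
    have e := (volume_preserving_piFinSuccAbove (fun _ : Fin (T + 1) => E) 0).symm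
    rw [← e.lintegral_comp_emb (MeasurableEquiv.measurableEmbedding _)]
    have hsplit : ∀ z : E × (Fin T → E), ENNReal.ofReal
        ((chainDensity (T + 1) P θ₀ ((MeasurableEquiv.piFinSuccAbove _ 0).symm z) /
          chainDensity (T + 1) Q θ₀ ((MeasurableEquiv.piFinSuccAbove _ 0).symm z)) ^ α *
          chainDensity (T + 1) Q θ₀ ((MeasurableEquiv.piFinSuccAbove _ 0).symm z)) =
        ENNReal.ofReal ((P 0 θ₀ z.1 / Q 0 θ₀ z.1) ^ α * Q 0 θ₀ z.1) * ENNReal.ofReal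
          ((chainDensity T (fun t => P (t + 1)) z.1 z.2 /
            chainDensity T (fun t => Q (t + 1)) z.1 z.2) ^ α *
            chainDensity T (fun t => Q (t + 1)) z.1 z.2) := fun z => by
      have h1 := hP 0 T.succ_pos θ₀ z.1
      have h2 := hQ 0 T.succ_pos θ₀ z.1
      have h3 := chainDensity_pos (T := T) (r := fun t => P (t + 1))
        (fun t ht => hP _ (by omega)) z.1 z.2
      have h4 := chainDensity_pos (T := T) (r := fun t => Q (t + 1))
        (fun t ht => hQ _ (by omega)) z.1 z.2
      rw [show (MeasurableEquiv.piFinSuccAbove (fun _ : Fin (T + 1) => E) 0).symm z =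
        Fin.cons z.1 z.2 from Fin.insertNth_zero' _ _,
        ← ENNReal.ofReal_mul (by positivity), chainDensity_cons, chainDensity_cons,
        mul_div_mul_comm, Real.mul_rpow (by positivity) (by positivity)]
      congr 1
      ring
    calc _ = ∫⁻ z : E × (Fin T → E), _ ∂(volume.prod volume) :=
          lintegral_congr hsplit
      _ ≤ ∫⁻ y, ∫⁻ x, _ := lintegral_prod_le _
      _ ≤ ∫⁻ y, ENNReal.ofReal ((P 0 θ₀ y / Q 0 θ₀ y) ^ α * Q 0 θ₀ y) *
            ∏ t ∈ range T, ENNReal.ofReal (B (t + 1)) := lintegral_mono fun y => by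
          simp only [lintegral_const_mul' _ _ ENNReal.ofReal_ne_top]
          exact mul_le_mul_right (hstep y) _
      _ ≤ _ := by
          rw [lintegral_mul_const' _ _ (ENNReal.prod_ne_top fun _ _ => ENNReal.ofReal_ne_top),
            prod_range_succ', mul_comm]
          exact mul_le_mul_right (hB 0 T.succ_pos θ₀) _

end Chain

lemma integral_le_of_lintegral_ofReal_le {Ω : Type*} [MeasurableSpace Ω] {μ : Measure Ω}
    {f : Ω → ℝ} (hf : ∀ x, 0 ≤ f x) {c : ℝ} (hc : 0 ≤ c)
    (h : ∫⁻ x, ENNReal.ofReal (f x) ∂μ ≤ ENNReal.ofReal c) : ∫ x, f x ∂μ ≤ c := by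
  by_cases hi : Integrable f μ
  · rw [← ofReal_integral_eq_lintegral_ofReal hi (Filter.Eventually.of_forall hf)] at h
    exact (ENNReal.ofReal_le_ofReal_iff hc).1 h
  · rwa [integral_undef hi]

lemma renyiDiv_le_of_lintegral_le {Ω : Type*} [MeasurableSpace Ω] {μ : Measure Ω} {α : ℝ}
    (hα : 1 < α) {P Q : Ω → ℝ} (hP : ∀ x, 0 ≤ P x) (hQ : ∀ x, 0 ≤ Q x) {c : ℝ} (hc : 1 ≤ c)
    (h : ∫⁻ x, ENNReal.ofReal ((P x / Q x) ^ α * Q x) ∂μ ≤ ENNReal.ofReal c) :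
    renyiDiv μ α P Q ≤ (α - 1)⁻¹ * Real.log c := by
  have hnn : ∀ x, 0 ≤ (P x / Q x) ^ α * Q x := fun x =>
    mul_nonneg (Real.rpow_nonneg (div_nonneg (hP x) (hQ x)) _) (hQ x)
  refine mul_le_mul_of_nonneg_left ?_ (inv_nonneg.2 (sub_nonneg.2 hα.le))
  rcases (integral_nonneg hnn : 0 ≤ ∫ x, (P x / Q x) ^ α * Q x ∂μ).eq_or_lt with h0 | h0
  · rw [← h0, Real.log_zero]
    exact Real.log_nonneg hc
  · exact Real.log_le_log h0 (integral_le_of_lintegral_ofReal_le hnn (by linarith) h)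

/-- T-step FSwoR-RDP upper bound, replace-one adjacency. -/
theorem stmt4 {X : Type*} {pd : ℕ} (hpd : 1 ≤ pd)
    (C : ℝ) (hC : 0 < C) (T : ℕ) (ηs σs : ℕ → ℝ)
    (hη : ∀ t < T, 0 < ηs t) (hσ : ∀ t < T, 0 < σs t)
    (k n : ℕ) (hk : 1 ≤ k) (hkn : k ≤ n)
    (g : EuclideanSpace ℝ (Fin pd) → X → EuclideanSpace ℝ (Fin pd))
    (D D' : Fin n → X) (hadj : AdjReplaceOne D D')
    (hq : (k : ℝ) / n < 1)
    (θ₀ : EuclideanSpace ℝ (Fin pd)) (α : ℝ) (hα : 1 < α) (m : ℕ) (hm : 3 ≤ m) :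
    renyiDiv volume α
        (chainDensity T (fun t θ θ' => pFSwoR C (ηs t) (σs t) k g n D θ θ') θ₀)
        (chainDensity T (fun t θ θ' => pFSwoR C (ηs t) (σs t) k g n D' θ θ') θ₀) ≤
      ∑ t ∈ Finset.range T,
        (α - 1)⁻¹ *
          Real.log (1 + ((k : ℝ) / n) ^ 2 * (α * (α - 1)) *
              (Real.exp (4 / (σs t) ^ 2) - Real.exp (2 / (σs t) ^ 2)) +
            (∑ j ∈ Finset.Icc 3 (m - 1),
              ((k : ℝ) / n) ^ j / (j.factorial : ℝ) * Ftil α (σs t) j) +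
            Etil α (σs t) m ((k : ℝ) / n)) := by
  have hn0 : (0 : ℝ) < n := by exact_mod_cast hk.trans hkn
  have hlt : k < n := by exact_mod_cast (div_lt_one hn0).1 hq
  have hB : ∀ t ∈ range T, 1 ≤ stepBound α (σs t) m ((k : ℝ) / n) := fun t ht =>
    one_le_stepBound hα (hσ t (mem_range.1 ht)) m (by positivity) hq
  have hpos := fun (D : Fin n → X) t (ht : t < T) =>
    pFSwoR_pos (g := g) hC (hη t ht) (hσ t ht) hk hkn D
  have h := renyiDiv_le_of_lintegral_le hα
    (fun x => (chainDensity_pos (hpos D) θ₀ x).le) (fun x => (chainDensity_pos (hpos D') θ₀ x).le)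
    (one_le_prod hB)
    ((lintegral_chainDensity_le T (hpos D) (hpos D') (fun t ht =>
      lintegral_pFSwoR_le hC (hη t ht) (hσ t ht) hk hlt hadj hα hm) θ₀).trans_eq
      (ENNReal.ofReal_prod_of_nonneg fun t ht => zero_le_one.trans (hB t ht)).symm)
  rwa [Real.log_prod fun t ht => (one_pos.trans_le (hB t ht)).ne', mul_sum] at h
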